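/- Lower bound for Korevaar–Schoen potentials: let (X, d, m) be a metric measure space satisfying the doubling condition and supporting a Poincaré inequality. Then there exists a constant C̃ > 0 depending only on the doubling constant such that for every Lipschitz f : X → ℝ, liminf_{r→0} ks_r[f](x)² ≥ C̃ · Lip[f](x)² for m-almost every x ∈ X. In particular one may take C̃ = (3/8)² / C_D⁵ where C_D is the doubling constant. -/

import Mathlib

open MeasureTheory Filter Metric Topology
open scoped ENNReal NNReal

/-- The Korevaar–Schoen energy density of `f` at scale `r`:
`ks_r[f](x) = ( ⨍_{B_r(x)} |f(y)-f(x)|²/r² dm(y) )^{1/2}`. -/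
noncomputable def ksr {X : Type*} [MetricSpace X] [MeasurableSpace X]
    (m : Measure X) (f : X → ℝ) (r : ℝ) (x : X) : ℝ :=
  Real.sqrt (⨍ y in Metric.ball x r, ((f y - f x) / r) ^ 2 ∂m)

/-- The pointwise Lipschitz constant `Lip[f](x) = limsup_{y→x} |f(y)-f(x)|/d(y,x)`. -/
noncomputable def pLip {X : Type*} [MetricSpace X] (f : X → ℝ) (x : X) : ℝ :=
  Filter.limsup (fun y => |f y - f x| / dist y x) (𝓝[≠] x)

/-- `g` is an upper gradient of `f` with respect to the distance `dd`:
for every absolutely continuous curve `γ : [0,1] → X`, with admissible speed `ℓ`,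
`|f(γ₁)-f(γ₀)| ≤ ∫₀¹ g(γ_s) ℓ(s) ds`. -/
def IsUpperGradientWrt {X : Type*} (dd : X → X → ℝ) (f g : X → ℝ) : Prop :=
  ∀ (γ : ℝ → X) (ℓ : ℝ → ℝ),
    (∀ s ∈ Set.Icc (0:ℝ) 1, 0 ≤ ℓ s) →
    IntervalIntegrable ℓ MeasureTheory.volume 0 1 →
    (∀ s t : ℝ, 0 ≤ s → s ≤ t → t ≤ 1 → dd (γ s) (γ t) ≤ ∫ u in s..t, ℓ u) →
    |f (γ 1) - f (γ 0)| ≤ ∫ s in (0:ℝ)..1, g (γ s) * ℓ s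

/-- Local doubling condition for the balls of the metric. -/
def LocDoubling {X : Type*} [MetricSpace X] [MeasurableSpace X] (m : Measure X) : Prop :=
  ∀ R : ℝ, 0 < R → ∃ C : ℝ≥0∞, 0 < C ∧ ∀ (x : X) (r : ℝ), 0 < r → r < R →
    m (Metric.ball x (2 * r)) ≤ C * m (Metric.ball x r)

/-- Local (2-)Poincaré inequality with dilation constant `Λ`. -/
def PoincareWith {X : Type*} [MetricSpace X] [MeasurableSpace X] (m : Measure X) (Λ : ℝ) : Prop :=
  ∀ R : ℝ, 0 < R → ∃ C : ℝ, 1 ≤ C ∧ ∀ (f g : X → ℝ) (x : X) (r : ℝ),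
    Measurable f → IsUpperGradientWrt dist f g → 0 < r → r < R →
    ⨍ y in Metric.ball x r, |f y - ⨍ z in Metric.ball x r, f z ∂m| ∂m ≤
      C * r * Real.sqrt (⨍ y in Metric.ball x (Λ * r), (g y) ^ 2 ∂m)

/-- A space supports a Poincaré inequality if it does for some dilation `Λ ≥ 1`. -/
def SupportsPoincare {X : Type*} [MetricSpace X] [MeasurableSpace X] (m : Measure X) : Prop :=
  ∃ Λ : ℝ, 1 ≤ Λ ∧ PoincareWith m Λ

section Doubling

variable {X : Type*} [MetricSpace X] [MeasurableSpace X] {m : Measure X} {C : ℝ≥0∞}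

theorem measure_ball_two_pow_mul_le
    (h : ∀ (x : X) (r : ℝ), 0 < r → m (ball x (2 * r)) ≤ C * m (ball x r))
    (n : ℕ) (x : X) {r : ℝ} (hr : 0 < r) : m (ball x (2 ^ n * r)) ≤ C ^ n * m (ball x r) := by
  induction n with
  | zero => simp
  | succ n ih =>
    calc m (ball x (2 ^ (n + 1) * r)) = m (ball x (2 * (2 ^ n * r))) := by ring_nf
      _ ≤ C * m (ball x (2 ^ n * r)) := h x _ (by positivity)
      _ ≤ C * (C ^ n * m (ball x r)) := by gcongr
      _ = C ^ (n + 1) * m (ball x r) := by ring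

theorem measure_ball_le_of_le
    (h : ∀ (x : X) (r : ℝ), 0 < r → m (ball x (2 * r)) ≤ C * m (ball x r))
    (n : ℕ) (x y : X) {r R : ℝ} (hr : 0 < r) (hR : R + dist x y ≤ 2 ^ n * r) :
    m (ball x R) ≤ C ^ n * m (ball y r) :=
  (measure_mono (ball_subset_ball' hR)).trans (measure_ball_two_pow_mul_le h n y hr)

theorem measure_ball_pos_of_doubling
    (h : ∀ (x : X) (r : ℝ), 0 < r → m (ball x (2 * r)) ≤ C * m (ball x r))
    (hm : m ≠ 0) (x : X) {r : ℝ} (hr : 0 < r) : 0 < m (ball x r) := by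
  by_contra! h0
  apply hm
  rw [← Measure.measure_univ_eq_zero]
  have hU : (Set.univ : Set X) = ⋃ n : ℕ, ball x (2 ^ n * r) := by
    symm
    rw [Set.eq_univ_iff_forall]
    intro y
    obtain ⟨n, hn⟩ := pow_unbounded_of_one_lt (dist y x / r) (one_lt_two (α := ℝ))
    exact Set.mem_iUnion.2 ⟨n, by rw [mem_ball]; rwa [div_lt_iff₀ hr] at hn⟩
  rw [hU, measure_iUnion_null_iff]
  intro n
  have := measure_ball_two_pow_mul_le h n x hr
  rw [nonpos_iff_eq_zero.1 h0, mul_zero] at this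
  exact nonpos_iff_eq_zero.1 this

theorem isUnifLocDoublingMeasure_of_ball
    (h : ∀ (x : X) (r : ℝ), 0 < r → m (ball x (2 * r)) ≤ C * m (ball x r)) (hC : C ≠ ∞) :
    IsUnifLocDoublingMeasure m := by
  refine ⟨⟨(C ^ 2).toNNReal, ?_⟩⟩
  filter_upwards [self_mem_nhdsWithin] with r (hr : 0 < r) x
  rw [ENNReal.coe_toNNReal (by finiteness)]
  calc m (closedBall x (2 * r)) ≤ m (ball x (2 ^ 2 * r)) :=
        measure_mono (closedBall_subset_ball (by linarith))
    _ ≤ C ^ 2 * m (ball x r) := measure_ball_two_pow_mul_le h 2 x hr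
    _ ≤ C ^ 2 * m (closedBall x r) := by gcongr; exact ball_subset_closedBall

/-- A weak-type estimate for the maximal function of the indicator of an open set. -/
theorem mul_measure_le_of_density [TopologicalSpace.SeparableSpace X] [BorelSpace X]
    (h : ∀ (x : X) (r : ℝ), 0 < r → m (ball x (2 * r)) ≤ C * m (ball x r))
    {B T : Set X} (hB : IsOpen B) {ρ : X → ℝ} {R : ℝ} {c : ℝ≥0∞}
    (hρ : ∀ x ∈ T, 0 < ρ x) (hρR : ∀ x ∈ T, ρ x ≤ R)
    (hT : ∀ x ∈ T, c * m (ball x (ρ x)) ≤ m (B ∩ ball x (ρ x))) :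
    c * m T ≤ C ^ 3 * m B := by
  obtain ⟨u, huT, hdisj, hcov⟩ := Vitali.exists_disjoint_subfamily_covering_enlargement_closedBall
    T id ρ R hρR 5 (by norm_num)
  have hu : u.Countable := by
    refine hdisj.countable_of_nonempty_interior fun x hx => ?_
    exact ⟨x, ball_subset_interior_closedBall (mem_ball_self (hρ x (huT hx)))⟩
  have hdisj' : u.PairwiseDisjoint fun x => B ∩ ball x (ρ x) :=
    hdisj.mono fun x => Set.inter_subset_right.trans ball_subset_closedBall
  have hsub : T ⊆ ⋃ x ∈ u, ball x (2 ^ 3 * ρ x) := fun x hx => by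
    obtain ⟨y, hy, hxy⟩ := hcov x hx
    refine Set.mem_biUnion hy ?_
    have h1 := hxy (mem_closedBall_self (hρ x hx).le)
    refine closedBall_subset_ball ?_ h1
    have := hρ y (huT hy)
    linarith
  calc c * m T ≤ c * ∑' x : u, m (ball (x : X) (2 ^ 3 * ρ x)) := by
        gcongr
        exact (measure_mono hsub).trans (measure_biUnion_le m hu _)
    _ ≤ c * ∑' x : u, C ^ 3 * m (ball (x : X) (ρ x)) := by
        gcongr with x
        exact measure_ball_two_pow_mul_le h 3 _ (hρ _ (huT x.2))
    _ = C ^ 3 * ∑' x : u, c * m (ball (x : X) (ρ x)) := by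
        rw [ENNReal.tsum_mul_left, ENNReal.tsum_mul_left]; ring
    _ ≤ C ^ 3 * ∑' x : u, m (B ∩ ball (x : X) (ρ x)) := by
        gcongr with x
        exact hT _ (huT x.2)
    _ = C ^ 3 * m (⋃ x ∈ u, B ∩ ball x (ρ x)) := by
        rw [measure_biUnion hu hdisj' fun x _ => (hB.inter isOpen_ball).measurableSet]
    _ ≤ C ^ 3 * m B := by
        gcongr
        exact Set.iUnion₂_subset fun x _ => Set.inter_subset_left

end Doubling

section UpperGradient

theorem isUpperGradientWrt_of_frequently {X : Type*} [MetricSpace X] [MeasurableSpace X]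
    [BorelSpace X] {u : X → ℝ} {K a s : ℝ} (hK : 0 ≤ K) (ha : 0 ≤ a) (hs : 0 < s)
    (hu : ∀ y z, dist y z ≤ s → |u y - u z| ≤ K * dist y z) {B : Set X} (hB : MeasurableSet B)
    (h : ∀ x ∉ B, ∃ᶠ r in 𝓝[>] (0 : ℝ), ∀ y ∈ ball x r, |u y - u x| ≤ a * r) :
    IsUpperGradientWrt dist u (fun x => a + B.indicator (fun _ => K) x) := by
  intro γ ℓ hℓ0 hℓ hγ
  set Lam : ℝ → ℝ := fun t => ∫ v in (0 : ℝ)..t, ℓ v with hLam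
  have hsub : ∀ t ∈ Set.Icc (0 : ℝ) 1, IntervalIntegrable ℓ volume 0 t := fun t ht =>
    hℓ.mono_set (by rw [Set.uIcc_of_le ht.1, Set.uIcc_of_le zero_le_one]
                    exact Set.Icc_subset_Icc_right ht.2)
  have hd : ∀ t t', 0 ≤ t → t ≤ t' → t' ≤ 1 → dist (γ t) (γ t') ≤ Lam t' - Lam t := by
    intro t t' h0 htt' h1
    rw [hLam]
    simp only
    rw [intervalIntegral.integral_interval_sub_left (hsub t' ⟨h0.trans htt', h1⟩)
      (hsub t ⟨h0, htt'.trans h1⟩)]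
    exact hγ t t' h0 htt' h1
  have hd' : ∀ t ∈ Set.Icc (0 : ℝ) 1, ∀ t' ∈ Set.Icc (0 : ℝ) 1,
      dist (γ t) (γ t') ≤ dist (Lam t) (Lam t') := by
    intro t ht t' ht'
    rw [Real.dist_eq]
    rcases le_total t t' with htt | htt
    · exact (hd t t' ht.1 htt ht'.2).trans (by rw [abs_sub_comm]; exact le_abs_self _)
    · rw [dist_comm]
      exact (hd t' t ht'.1 htt ht.2).trans (le_abs_self _)
  have hLamAC : AbsolutelyContinuousOnInterval Lam 0 1 :=
    hℓ.absolutelyContinuousOnInterval_intervalIntegral (by simp)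
  have hγc : ContinuousOn γ (Set.Icc 0 1) := by
    have h1 := hLamAC.continuousOn
    rw [Set.uIcc_of_le zero_le_one] at h1
    rw [Metric.continuousOn_iff] at h1 ⊢
    intro t ht ε hε
    obtain ⟨δ, hδ, h2⟩ := h1 t ht ε hε
    exact ⟨δ, hδ, fun t' ht' hlt => (hd' t' ht' t ht).trans_lt (h2 t' ht' hlt)⟩
  set φ : ℝ → ℝ := fun t => u (γ t) with hφ
  have hφAC : AbsolutelyContinuousOnInterval φ 0 1 := by
    rw [absolutelyContinuousOnInterval_iff] at hLamAC ⊢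
    intro ε hε
    obtain ⟨δ, hδ, h1⟩ := hLamAC (min s (ε / (K + 1))) (by positivity)
    refine ⟨δ, hδ, fun E hE hEδ => ?_⟩
    have h2 := h1 E hE hEδ
    have hmem : ∀ i ∈ Finset.range E.1, (E.2 i).1 ∈ Set.Icc (0 : ℝ) 1 ∧
        (E.2 i).2 ∈ Set.Icc (0 : ℝ) 1 := by
      have := hE.1
      rwa [Set.uIcc_of_le zero_le_one] at this
    calc ∑ i ∈ Finset.range E.1, dist (φ (E.2 i).1) (φ (E.2 i).2)
        ≤ ∑ i ∈ Finset.range E.1, K * dist (Lam (E.2 i).1) (Lam (E.2 i).2) := by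
          refine Finset.sum_le_sum fun i hi => ?_
          have h3 := hd' _ (hmem i hi).1 _ (hmem i hi).2
          have h4 : dist (Lam (E.2 i).1) (Lam (E.2 i).2) ≤ s :=
            (Finset.single_le_sum (f := fun i => dist (Lam (E.2 i).1) (Lam (E.2 i).2))
              (fun _ _ => dist_nonneg) hi).trans (h2.le.trans (min_le_left _ _))
          exact (hu _ _ (h3.trans h4)).trans (by gcongr)
      _ = K * ∑ i ∈ Finset.range E.1, dist (Lam (E.2 i).1) (Lam (E.2 i).2) := by
          rw [Finset.mul_sum]
      _ ≤ K * (ε / (K + 1)) := by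
          gcongr
          exact h2.le.trans (min_le_right _ _)
      _ < ε := by
          rw [mul_div_assoc', div_lt_iff₀ (by positivity)]
          nlinarith
  have hgmeas : Measurable fun x => a + B.indicator (fun _ => K) x :=
    measurable_const.add (measurable_const.indicator hB)
  have hgℓ : IntervalIntegrable (fun t => (a + B.indicator (fun _ => K) (γ t)) * ℓ t)
      volume 0 1 := by
    rw [intervalIntegrable_iff, Set.uIoc_of_le zero_le_one] at hℓ ⊢
    refine Integrable.bdd_mul (c := a + K) hℓ ?_ ?_
    · have : AEMeasurable γ (volume.restrict (Set.Ioc 0 1)) :=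
        (hγc.mono Set.Ioc_subset_Icc_self).aemeasurable measurableSet_Ioc
      exact (hgmeas.comp_aemeasurable this).aestronglyMeasurable
    · refine Eventually.of_forall fun t => ?_
      rw [Real.norm_eq_abs, abs_of_nonneg]
      · gcongr
        exact Set.indicator_le_self' (fun _ _ => hK) _
      · exact add_nonneg ha (Set.indicator_nonneg (fun _ _ => hK) _)
  have hpt : ∀ᵐ t : ℝ, t ∈ Set.Ioo (0 : ℝ) 1 →
      |deriv φ t| ≤ (a + B.indicator (fun _ => K) (γ t)) * ℓ t := by
    filter_upwards [hφAC.ae_differentiableAt, hℓ.ae_hasDerivAt_integral] with t h1 h2 ht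
    have htI : t ∈ Set.uIcc (0 : ℝ) 1 := by
      rw [Set.uIcc_of_le zero_le_one]; exact Set.Ioo_subset_Icc_self ht
    have hl := hℓ0 t (Set.Ioo_subset_Icc_self ht)
    have hφ' := (h1 htI).hasDerivAt
    have hLam' : HasDerivAt Lam (ℓ t) t := h2 htI 0 (by simp)
    have hinc : ∀ᶠ h' in 𝓝[>] (0 : ℝ), 0 < h' ∧
        dist (γ (t + h')) (γ t) ≤ Lam (t + h') - Lam t := by
      filter_upwards [Ioo_mem_nhdsGT (sub_pos.2 ht.2)] with h' hh'
      refine ⟨hh'.1, ?_⟩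
      rw [dist_comm]
      exact hd t (t + h') ht.1.le (by linarith [hh'.1]) (by linarith [hh'.2])
    have hLs : Tendsto (fun h' => h'⁻¹ • (Lam (t + h') - Lam t)) (𝓝[>] 0) (𝓝 (ℓ t)) :=
      hLam'.tendsto_slope_zero_right
    have hφs : Tendsto (fun h' => |h'⁻¹ • (φ (t + h') - φ t)|) (𝓝[>] 0) (𝓝 |deriv φ t|) :=
      hφ'.tendsto_slope_zero_right.abs
    have hLlt : ∀ ε > 0, ∀ᶠ h' in 𝓝[>] (0 : ℝ), Lam (t + h') - Lam t < (ℓ t + ε) * h' := by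
      intro ε hε
      filter_upwards [hLs.eventually_lt_const (lt_add_of_pos_right (ℓ t) hε), hinc] with h' h3 h4
      rwa [smul_eq_mul, inv_mul_lt_iff₀ h4.1, mul_comm] at h3
    have hfreq : ∀ ε > 0, ∃ᶠ h' in 𝓝[>] (0 : ℝ),
        |φ (t + h') - φ t| ≤ (a + B.indicator (fun _ => K) (γ t)) * ((ℓ t + ε) * h') := by
      intro ε hε
      by_cases hγB : γ t ∈ B
      · refine Eventually.frequently ?_
        have hsm : Tendsto (fun h' : ℝ => (ℓ t + ε) * h') (𝓝[>] 0) (𝓝 0) := by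
          have : Tendsto (fun h' : ℝ => (ℓ t + ε) * h') (𝓝 0) (𝓝 ((ℓ t + ε) * 0)) :=
            tendsto_id.const_mul _
          rw [mul_zero] at this
          exact this.mono_left nhdsWithin_le_nhds
        filter_upwards [hinc, hLlt ε hε, hsm.eventually_le_const hs] with h' h3 h4 h5
        have h6 : dist (γ (t + h')) (γ t) ≤ (ℓ t + ε) * h' := h3.2.trans h4.le
        have := hu _ _ (h6.trans h5)
        rw [Set.indicator_of_mem hγB]
        have h7 : 0 ≤ (ℓ t + ε) * h' := dist_nonneg.trans h6
        calc |φ (t + h') - φ t| ≤ K * ((ℓ t + ε) * h') := this.trans (by gcongr)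
          _ ≤ (a + K) * ((ℓ t + ε) * h') := by gcongr; linarith
      · have hpos : 0 < ℓ t + ε := by linarith
        have hmap : Tendsto (fun r : ℝ => r / (ℓ t + ε)) (𝓝[>] 0) (𝓝[>] 0) := by
          refine tendsto_nhdsWithin_iff.2 ⟨?_, ?_⟩
          · have : Tendsto (fun r : ℝ => r / (ℓ t + ε)) (𝓝 0) (𝓝 (0 / (ℓ t + ε))) :=
              tendsto_id.div_const _
            rw [zero_div] at this
            exact this.mono_left nhdsWithin_le_nhds
          · filter_upwards [self_mem_nhdsWithin] with r hr
            exact div_pos hr hpos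
        refine hmap.frequently ?_
        refine ((h _ hγB).and_eventually (hmap.eventually (hinc.and (hLlt ε hε)))).mono ?_
        rintro r ⟨h3, ⟨-, h4⟩, h5⟩
        have h6 : (ℓ t + ε) * (r / (ℓ t + ε)) = r := mul_div_cancel₀ r hpos.ne'
        rw [h6] at h5 ⊢
        rw [Set.indicator_of_notMem hγB, add_zero]
        exact h3 _ (mem_ball.2 (h4.trans_lt h5))
    have hgt : 0 ≤ a + B.indicator (fun _ => K) (γ t) :=
      add_nonneg ha (Set.indicator_nonneg (fun _ _ => hK) _)
    have hε : ∀ ε > 0, |deriv φ t| ≤ (a + B.indicator (fun _ => K) (γ t)) * (ℓ t + ε) := by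
      intro ε hε
      refine le_of_tendsto_of_frequently hφs ?_
      refine ((hfreq ε hε).and_eventually hinc).mono ?_
      rintro h' ⟨h3, h4, -⟩
      rw [smul_eq_mul, abs_mul, abs_of_pos (inv_pos.2 h4), inv_mul_le_iff₀ h4]
      linarith
    have hlim : Tendsto (fun ε : ℝ => (a + B.indicator (fun _ => K) (γ t)) * (ℓ t + ε))
        (𝓝[>] 0) (𝓝 ((a + B.indicator (fun _ => K) (γ t)) * (ℓ t + 0))) :=
      ((tendsto_const_nhds.add tendsto_id).const_mul _).mono_left nhdsWithin_le_nhds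
    rw [add_zero] at hlim
    exact ge_of_tendsto hlim (by filter_upwards [self_mem_nhdsWithin] with ε h using hε ε h)
  calc |u (γ 1) - u (γ 0)| = |∫ t in (0 : ℝ)..1, deriv φ t| := by
        rw [hφAC.integral_deriv_eq_sub]
    _ ≤ ∫ t in (0 : ℝ)..1, |deriv φ t| :=
        intervalIntegral.abs_integral_le_integral_abs zero_le_one
    _ ≤ _ := by
        refine intervalIntegral.integral_mono_ae_restrict zero_le_one
          hφAC.intervalIntegrable_deriv.abs hgℓ ?_
        rw [← restrict_Ioo_eq_restrict_Icc]
        exact (ae_restrict_iff' measurableSet_Ioo).2 hpt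

end UpperGradient

section Chains

variable {X : Type*} [MetricSpace X]

open Classical in
/-- The cost of a step of a chain: steps touching `M` are charged at slope `b`, the other ones
at slope `K`. -/
noncomputable def stepCost (M : Set X) (b K : ℝ) (y z : X) : ℝ :=
  (if y ∈ M ∨ z ∈ M then b else K) * dist y z

/-- `ChainCost M b K s x y ℓ` means that some chain from `x` to `y` with steps of size at most `s`
has total cost `ℓ`. -/
inductive ChainCost (M : Set X) (b K s : ℝ) (x : X) : X → ℝ → Prop
  | nil : ChainCost M b K s x x 0
  | snoc {y z : X} {ℓ : ℝ} : ChainCost M b K s x y ℓ → dist y z ≤ s →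
      ChainCost M b K s x z (ℓ + stepCost M b K y z)

theorem stepCost_comm (M : Set X) (b K : ℝ) (y z : X) :
    stepCost M b K y z = stepCost M b K z y := by
  rw [stepCost, stepCost, dist_comm]
  congr 1
  by_cases hy : y ∈ M <;> by_cases hz : z ∈ M <;> simp [hy, hz]

theorem stepCost_of_mem {M : Set X} {b K : ℝ} {y z : X} (h : y ∈ M ∨ z ∈ M) :
    stepCost M b K y z = b * dist y z := by
  rw [stepCost, if_pos h]

theorem stepCost_of_notMem {M : Set X} {b K : ℝ} {y z : X} (hy : y ∉ M) (hz : z ∉ M) :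
    stepCost M b K y z = K * dist y z := by
  rw [stepCost, if_neg (by tauto)]

theorem stepCost_le {M : Set X} {b K : ℝ} (hbK : b ≤ K) (y z : X) :
    stepCost M b K y z ≤ K * dist y z := by
  rw [stepCost]; gcongr; split_ifs <;> simp [hbK]

theorem le_stepCost {M : Set X} {b K : ℝ} (hbK : b ≤ K) (y z : X) :
    b * dist y z ≤ stepCost M b K y z := by
  rw [stepCost]; gcongr; split_ifs <;> simp [hbK]

/-- The increments of `f` along chains are controlled by the cost, up to a small error, if around
every point of `M` there is a ball, much larger than the steps, on which `f` oscillates little. -/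
theorem ChainCost.sub_le {f : X → ℝ} {K a b s ρ : ℝ} {M : Set X} {r : X → ℝ}
    (hf : ∀ y z, |f y - f z| ≤ K * dist y z) (hK : 0 ≤ K) (ha : 0 ≤ a) (hb : 0 ≤ b) (hbK : b ≤ K)
    (hs : 0 ≤ s) (hρ : 0 ≤ ρ)
    (hr : ∀ x ∈ M, 0 < r x) (hrρ : ∀ x ∈ M, r x ≤ ρ) (hrs : ∀ x ∈ M, 2 * K * s ≤ (b - a) * r x)
    (hosc : ∀ x ∈ M, ∀ y ∈ ball x (r x), |f y - f x| ≤ a * r x)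
    {x y : X} {ℓ : ℝ} (h : ChainCost M b K s x y ℓ) : f y - f x ≤ ℓ + (K * s + a * ρ) := by
  have hKs : 0 ≤ K * s := mul_nonneg hK hs
  suffices H : ∃ x' ℓ', f x' - f x ≤ ℓ' + K * s ∧ b * dist x' y ≤ ℓ - ℓ' ∧
      (x' ∈ M → dist y x' < r x') ∧ (x' ∉ M → y = x' ∧ f x' - f x ≤ ℓ') by
    obtain ⟨x', ℓ', h1, h2, h3, h4⟩ := H
    have h5 : 0 ≤ b * dist x' y := by positivity
    by_cases hx' : x' ∈ M
    · have h6 := (abs_le.1 (hosc x' hx' y (h3 hx'))).2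
      have h7 : a * r x' ≤ a * ρ := by gcongr; exact hrρ x' hx'
      linarith
    · obtain ⟨rfl, h6⟩ := h4 hx'
      have : 0 ≤ a * ρ := by positivity
      linarith
  induction h with
  | nil =>
    refine ⟨x, 0, by simpa using hKs, by simp, fun hx => by simpa using hr x hx, fun _ => ?_⟩
    simp
  | @snoc y z ℓ _ hyz ih =>
    obtain ⟨x', ℓ', h1, h2, h3, h4⟩ := ih
    have hc := le_stepCost (M := M) hbK y z
    have hfz := (abs_le.1 (hf z y)).2
    rw [dist_comm] at hfz
    have htri : b * dist x' z ≤ b * dist x' y + b * dist y z := by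
      rw [← mul_add]; gcongr; exact dist_triangle _ _ _
    by_cases hx' : x' ∈ M
    · by_cases hz : dist z x' < r x'
      · exact ⟨x', ℓ', h1, by linarith, fun _ => hz, fun h => absurd hx' h⟩
      · have h5 : f z - f x ≤ ℓ + stepCost M b K y z := by
          have h6 := (abs_le.1 (hosc x' hx' y (h3 hx'))).2
          have h7 := hrs x' hx'
          have h8 : b * r x' ≤ b * dist x' z := by
            rw [dist_comm]; gcongr; exact not_lt.1 hz
          have h9 : K * dist y z ≤ K * s := by gcongr
          linarith
        exact ⟨z, _, by linarith, by simp, fun hz => by simpa using hr z hz, fun _ => ⟨rfl, h5⟩⟩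
    · obtain ⟨rfl, h5⟩ := h4 hx'
      rw [dist_self, mul_zero] at h2
      have h9 : K * dist y z ≤ K * s := by gcongr
      have h10 : 0 ≤ stepCost M b K y z := le_trans (by positivity) hc
      refine ⟨z, ℓ + stepCost M b K y z, by linarith, by simp,
        fun hz => by simpa using hr z hz, fun hz => ⟨rfl, ?_⟩⟩
      rw [stepCost_of_notMem hx' hz]
      linarith

/-- A Lipschitz function oscillating little on some ball around each point of `M` is uniformly
close to a function with small slope at each point of `M`. -/
theorem exists_approx_of_oscillation {f : X → ℝ} {K a b s ρ : ℝ} {M : Set X} {r : X → ℝ}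
    (hf : ∀ y z, |f y - f z| ≤ K * dist y z) (hK : 0 ≤ K) (ha : 0 ≤ a) (hb : 0 ≤ b) (hbK : b ≤ K)
    (hs : 0 ≤ s) (hρ : 0 ≤ ρ)
    (hr : ∀ x ∈ M, 0 < r x) (hrρ : ∀ x ∈ M, r x ≤ ρ) (hrs : ∀ x ∈ M, 2 * K * s ≤ (b - a) * r x)
    (hosc : ∀ x ∈ M, ∀ y ∈ ball x (r x), |f y - f x| ≤ a * r x) :
    ∃ u : X → ℝ, (∀ y, |u y - f y| ≤ K * s + a * ρ) ∧
      (∀ y z, dist y z ≤ s → |u y - u z| ≤ K * dist y z) ∧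
      (∀ y ∈ M, ∀ z, dist y z ≤ s → |u y - u z| ≤ b * dist y z) := by
  let S : X → Set ℝ := fun y => {t | ∃ x ℓ, ChainCost M b K s x y ℓ ∧ t = f x + ℓ}
  have hlb : ∀ y, ∀ t ∈ S y, f y - (K * s + a * ρ) ≤ t := by
    rintro y t ⟨x, ℓ, h, rfl⟩
    have := h.sub_le hf hK ha hb hbK hs hρ hr hrρ hrs hosc
    linarith
  have hbdd : ∀ y, BddBelow (S y) := fun y => ⟨_, hlb y⟩
  have hmem : ∀ y, f y ∈ S y := fun y => ⟨y, 0, .nil, by simp⟩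
  have hstep : ∀ y z, dist y z ≤ s → sInf (S z) - sInf (S y) ≤ stepCost M b K y z := by
    intro y z hyz
    have : sInf (S z) - stepCost M b K y z ≤ sInf (S y) := by
      refine le_csInf ⟨_, hmem y⟩ ?_
      rintro t ⟨x, ℓ, h, rfl⟩
      have : sInf (S z) ≤ f x + (ℓ + stepCost M b K y z) := csInf_le (hbdd z) ⟨x, _, h.snoc hyz, rfl⟩
      linarith
    linarith
  have habs : ∀ y z, dist y z ≤ s → |sInf (S y) - sInf (S z)| ≤ stepCost M b K y z := by
    intro y z hyz
    rw [abs_le]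
    have h1 := hstep y z hyz
    have h2 := hstep z y (by rwa [dist_comm])
    rw [stepCost_comm] at h2
    constructor <;> linarith
  refine ⟨fun y => sInf (S y), fun y => ?_, fun y z hyz => ?_, fun y hy z hyz => ?_⟩
  · have h1 : sInf (S y) ≤ f y := csInf_le (hbdd y) (hmem y)
    have h2 : f y - (K * s + a * ρ) ≤ sInf (S y) := le_csInf ⟨_, hmem y⟩ (hlb y)
    rw [abs_le]
    constructor <;> linarith
  · exact (habs y z hyz).trans (stepCost_le hbK y z)
  · rw [← stepCost_of_mem (K := K) (Or.inl hy)]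
    exact habs y z hyz

end Chains

section Hilbert

/-- A Mazur-type lemma for a decreasing sequence of midpoint-convex sets and a sequence of
asymptotically quadratic, asymptotically bounded functionals. -/
theorem exists_frequently_lt_of_parallelogram {V : Type*} [AddCommGroup V] [Module ℝ V]
    {Q : ℕ → V → ℝ} {U : ℕ → Set V} {c ε : ℝ} (hU : Antitone U) (hne : ∀ n, (U n).Nonempty)
    (hmid : ∀ n, ∀ u ∈ U n, ∀ v ∈ U n, (1 / 2 : ℝ) • (u + v) ∈ U n)
    (hQ0 : ∀ i u, 0 ≤ Q i u) (hQc : ∀ u ∈ U 0, ∀ᶠ i in atTop, Q i u ≤ c)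
    (hpar : ∀ u ∈ U 0, ∀ v ∈ U 0, ∀ᶠ i in atTop,
      Q i (u - v) + 4 * Q i ((1 / 2 : ℝ) • (u + v)) = 2 * Q i u + 2 * Q i v)
    (hε : 0 < ε) :
    ∃ u ∈ U 0, ∀ k, ∃ v ∈ U k, ∃ᶠ i in atTop, Q i (u - v) < ε := by
  let F : Ultrafilter ℕ := hyperfilter ℕ
  have hF : (F : Filter ℕ) ≤ atTop := Nat.hyperfilter_le_atTop
  have hex : ∀ u, ∃ l, u ∈ U 0 → 0 ≤ l ∧ l ≤ c ∧ Tendsto (fun i => Q i u) F (𝓝 l) := by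
    intro u
    by_cases hu : u ∈ U 0
    · obtain ⟨l, hl, hlim⟩ := (isCompact_Icc (a := (0 : ℝ)) (b := c)).ultrafilter_le_nhds
        (F.map fun i => Q i u) (by
          rw [le_principal_iff]
          exact hF ((hQc u hu).mono fun i hi => ⟨hQ0 i u, hi⟩))
      exact ⟨l, fun _ => ⟨hl.1, hl.2, hlim⟩⟩
    · exact ⟨0, fun h => absurd h hu⟩
  choose J hJ using hex
  have hsub : ∀ n, U n ⊆ U 0 := fun n => hU (Nat.zero_le n)
  have hbdd : ∀ n, BddBelow (J '' U n) := fun n => ⟨0, by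
    rintro _ ⟨u, hu, rfl⟩
    exact (hJ u (hsub n hu)).1⟩
  let I : ℕ → ℝ := fun n => sInf (J '' U n)
  have hIle : ∀ n, ∀ u ∈ U n, I n ≤ J u := fun n u hu => csInf_le (hbdd n) ⟨u, hu, rfl⟩
  have hex' : ∀ n, ∀ δ > 0, ∃ u ∈ U n, J u < I n + δ := by
    intro n δ hδ
    obtain ⟨_, ⟨u, hu, rfl⟩, h⟩ := exists_lt_of_csInf_lt ((hne n).image J)
      (lt_add_of_pos_right (I n) hδ)
    exact ⟨u, hu, h⟩
  have hIbdd : BddAbove (Set.range I) := ⟨c, by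
    rintro _ ⟨n, rfl⟩
    obtain ⟨u, hu⟩ := hne n
    exact (hIle n u hu).trans (hJ u (hsub n hu)).2.1⟩
  obtain ⟨n, hn⟩ := exists_lt_of_lt_ciSup (show (⨆ n, I n) - ε / 7 < ⨆ n, I n by linarith)
  obtain ⟨u, hu, hJu⟩ := hex' n (ε / 7) (by positivity)
  refine ⟨u, hsub n hu, fun k => ?_⟩
  obtain ⟨v, hv, hJv⟩ := hex' (max k n) (ε / 7) (by positivity)
  have hvn : v ∈ U n := hU (le_max_right k n) hv
  refine ⟨v, hU (le_max_left k n) hv, ?_⟩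
  have hw := hmid n u hu v hvn
  have hIN : I (max k n) ≤ ⨆ n, I n := le_ciSup hIbdd _
  have hlim : Tendsto (fun i => 2 * Q i u + 2 * Q i v - 4 * Q i ((1 / 2 : ℝ) • (u + v))) F
      (𝓝 (2 * J u + 2 * J v - 4 * J ((1 / 2 : ℝ) • (u + v)))) :=
    (((hJ u (hsub n hu)).2.2.const_mul 2).add ((hJ v (hsub n hvn)).2.2.const_mul 2)).sub
      ((hJ _ (hsub n hw)).2.2.const_mul 4)
  have hlt : 2 * J u + 2 * J v - 4 * J ((1 / 2 : ℝ) • (u + v)) < ε := by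
    have := hIle n _ hw
    linarith
  have hev : ∀ᶠ i in (F : Filter ℕ), Q i (u - v) < ε := by
    filter_upwards [hlim.eventually_lt_const hlt, hF (hpar u (hsub n hu) v (hsub n hvn))]
      with i h1 h2
    linarith
  exact hev.frequently.filter_mono hF

end Hilbert

section Energy

variable {X : Type*} [MetricSpace X] [MeasurableSpace X]

/-- The measure on `X × X` whose disintegration with respect to `m` is given by the normalized
restrictions of `m` to balls of radius `ρ`. -/
noncomputable def ballPairMeasure (m : Measure X) (ρ : ℝ) : Measure (X × X) :=
  (m.prod m).withDensity
    ({p : X × X | dist p.2 p.1 < ρ}.indicator fun p => (m (ball p.1 ρ))⁻¹)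

/-- The integral of the squared Korevaar–Schoen energy density at scale `ρ`. -/
noncomputable def ksEnergy (m : Measure X) (ρ : ℝ) (u : X → ℝ) : ℝ :=
  ∫ p, (u p.2 - u p.1) ^ 2 / ρ ^ 2 ∂(ballPairMeasure m ρ)

theorem ksEnergy_nonneg (m : Measure X) (ρ : ℝ) (u : X → ℝ) : 0 ≤ ksEnergy m ρ u :=
  integral_nonneg fun _ => by positivity

variable [SecondCountableTopology X] [BorelSpace X] {m : Measure X} [IsFiniteMeasure m]

theorem measurableSet_dist_lt (ρ : ℝ) : MeasurableSet {p : X × X | dist p.2 p.1 < ρ} :=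
  (isOpen_lt (continuous_snd.dist continuous_fst) continuous_const).measurableSet

theorem measurable_measure_ball (ρ : ℝ) : Measurable fun x : X => m (ball x ρ) :=
  measurable_measure_prodMk_left (measurableSet_dist_lt ρ)

theorem measurable_ballPairMeasure_density (ρ : ℝ) :
    Measurable ({p : X × X | dist p.2 p.1 < ρ}.indicator fun p => (m (ball p.1 ρ))⁻¹) :=
  ((measurable_measure_ball ρ).comp measurable_fst).inv.indicator (measurableSet_dist_lt ρ)

theorem lintegral_ballPairMeasure (ρ : ℝ) {F : X × X → ℝ≥0∞} (hF : Measurable F) :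
    ∫⁻ p, F p ∂(ballPairMeasure m ρ) =
      ∫⁻ x, (m (ball x ρ))⁻¹ * ∫⁻ y in ball x ρ, F (x, y) ∂m ∂m := by
  have hD := measurable_ballPairMeasure_density (m := m) ρ
  rw [ballPairMeasure, lintegral_withDensity_eq_lintegral_mul _ hD hF,
    lintegral_prod _ (hD.mul hF).aemeasurable]
  refine lintegral_congr fun x => ?_
  have hFx : Measurable fun y => F (x, y) := hF.comp measurable_prodMk_left
  rw [← lintegral_const_mul _ hFx, ← lintegral_indicator measurableSet_ball]
  refine lintegral_congr fun y => ?_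
  by_cases h : dist y x < ρ
  · simp [Set.indicator, h]
  · simp [Set.indicator, h]

theorem ballPairMeasure_univ_le (ρ : ℝ) : ballPairMeasure m ρ Set.univ ≤ m Set.univ := by
  have := lintegral_ballPairMeasure (m := m) ρ (F := fun _ => 1) measurable_const
  rw [lintegral_one] at this
  rw [this, ← lintegral_one]
  refine lintegral_mono fun x => ?_
  rw [lintegral_one, Measure.restrict_apply_univ]
  exact ENNReal.inv_mul_le_one _

instance (ρ : ℝ) : IsFiniteMeasure (ballPairMeasure m ρ) :=
  ⟨(ballPairMeasure_univ_le ρ).trans_lt (measure_lt_top m _)⟩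

theorem ae_ballPairMeasure (ρ : ℝ) : ∀ᵐ p ∂(ballPairMeasure m ρ), dist p.2 p.1 < ρ := by
  rw [ballPairMeasure, ae_withDensity_iff (measurable_ballPairMeasure_density ρ)]
  refine Eventually.of_forall fun p hp => ?_
  by_contra h
  exact hp (by simp [Set.indicator, h])

theorem ae_sq_div_sq_le {u : X → ℝ} {K s ρ : ℝ} (hρ : 0 < ρ) (hρs : ρ ≤ s)
    (hu : ∀ y z, dist y z ≤ s → |u y - u z| ≤ K * dist y z) :
    ∀ᵐ p ∂(ballPairMeasure m ρ), (u p.2 - u p.1) ^ 2 / ρ ^ 2 ≤ K ^ 2 := by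
  filter_upwards [ae_ballPairMeasure ρ] with p hp
  rw [div_le_iff₀ (by positivity), ← mul_pow, ← sq_abs]
  have h1 := hu p.2 p.1 (hp.le.trans hρs)
  have hK : 0 ≤ K ∨ dist p.2 p.1 = 0 := by
    by_contra! h
    have h2 : 0 < dist p.2 p.1 := lt_of_le_of_ne dist_nonneg (Ne.symm h.2)
    nlinarith [abs_nonneg (u p.2 - u p.1)]
  rcases hK with hK | h0
  · gcongr
    exact h1.trans (by gcongr)
  · rw [h0, mul_zero] at h1
    rw [le_antisymm h1 (abs_nonneg _), zero_pow two_ne_zero]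
    exact sq_nonneg _

theorem continuous_of_locally_lipschitz {X : Type*} [MetricSpace X] {u : X → ℝ} {K s : ℝ}
    (hs : 0 < s) (hu : ∀ y z, dist y z ≤ s → |u y - u z| ≤ K * dist y z) : Continuous u := by
  rw [Metric.continuous_iff]
  intro x ε hε
  refine ⟨min s (ε / (|K| + 1)), by positivity, fun y hy => ?_⟩
  have h1 := hu y x (hy.le.trans (min_le_left _ _))
  have h2 := hy.le.trans (min_le_right _ _)
  rw [Real.dist_eq]
  calc |u y - u x| ≤ |K| * dist y x := h1.trans (by gcongr; exact le_abs_self K)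
    _ ≤ |K| * (ε / (|K| + 1)) := by gcongr
    _ < ε := by
      rw [mul_div_assoc', div_lt_iff₀ (by positivity)]
      nlinarith [abs_nonneg K]

theorem integrable_sq_div_sq {u : X → ℝ} {K s ρ : ℝ} (hρ : 0 < ρ) (hρs : ρ ≤ s)
    (hu : ∀ y z, dist y z ≤ s → |u y - u z| ≤ K * dist y z) :
    Integrable (fun p : X × X => (u p.2 - u p.1) ^ 2 / ρ ^ 2) (ballPairMeasure m ρ) := by
  have hc := continuous_of_locally_lipschitz (hρ.trans_le hρs) hu
  refine Integrable.of_bound (C := K ^ 2) (by fun_prop) ?_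
  filter_upwards [ae_sq_div_sq_le hρ hρs hu] with p hp
  rwa [Real.norm_eq_abs, abs_of_nonneg (by positivity)]

theorem ksEnergy_le {u : X → ℝ} {K s ρ : ℝ} (hρ : 0 < ρ) (hρs : ρ ≤ s)
    (hu : ∀ y z, dist y z ≤ s → |u y - u z| ≤ K * dist y z) :
    ksEnergy m ρ u ≤ K ^ 2 * m.real Set.univ := by
  calc ksEnergy m ρ u ≤ ∫ _, K ^ 2 ∂(ballPairMeasure m ρ) :=
        integral_mono_ae (integrable_sq_div_sq hρ hρs hu) (integrable_const _)
          (ae_sq_div_sq_le hρ hρs hu)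
    _ = K ^ 2 * (ballPairMeasure m ρ).real Set.univ := by
        rw [integral_const, smul_eq_mul, mul_comm]
    _ ≤ K ^ 2 * m.real Set.univ := by
        gcongr
        exact ENNReal.toReal_mono (measure_ne_top m _) (ballPairMeasure_univ_le ρ)

theorem ksEnergy_parallelogram {u v : X → ℝ} {K s ρ : ℝ} (hρ : 0 < ρ) (hρs : ρ ≤ s)
    (hu : ∀ y z, dist y z ≤ s → |u y - u z| ≤ K * dist y z)
    (hv : ∀ y z, dist y z ≤ s → |v y - v z| ≤ K * dist y z) :
    ksEnergy m ρ (u - v) + 4 * ksEnergy m ρ ((1 / 2 : ℝ) • (u + v)) =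
      2 * ksEnergy m ρ u + 2 * ksEnergy m ρ v := by
  have hsub : ∀ y z, dist y z ≤ s → |(u - v) y - (u - v) z| ≤ (2 * K) * dist y z := by
    intro y z h
    have h1 := abs_le.1 (hu y z h)
    have h2 := abs_le.1 (hv y z h)
    simp only [Pi.sub_apply]
    rw [abs_le]
    constructor <;> linarith
  have hadd : ∀ y z, dist y z ≤ s →
      |((1 / 2 : ℝ) • (u + v)) y - ((1 / 2 : ℝ) • (u + v)) z| ≤ K * dist y z := by
    intro y z h
    have h1 := abs_le.1 (hu y z h)
    have h2 := abs_le.1 (hv y z h)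
    simp only [Pi.smul_apply, Pi.add_apply, smul_eq_mul]
    rw [abs_le]
    constructor <;> linarith
  simp only [ksEnergy]
  rw [← integral_const_mul, ← integral_const_mul, ← integral_const_mul,
    ← integral_add (integrable_sq_div_sq hρ hρs hsub)
      ((integrable_sq_div_sq hρ hρs hadd).const_mul 4),
    ← integral_add ((integrable_sq_div_sq hρ hρs hu).const_mul 2)
      ((integrable_sq_div_sq hρ hρs hv).const_mul 2)]
  refine integral_congr_ae (Eventually.of_forall fun p => ?_)
  simp only [Pi.sub_apply, Pi.smul_apply, Pi.add_apply, smul_eq_mul]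
  field_simp
  ring

/-- Chebyshev's inequality: the set of points around which a locally Lipschitz function oscillates
at scale `ρ` is controlled by its energy at scale `ρ`. -/
theorem mul_measure_oscillation_le {C : ℝ≥0∞}
    (h : ∀ (x : X) (r : ℝ), 0 < r → m (ball x (2 * r)) ≤ C * m (ball x r)) (hC : C ≠ ∞)
    (hpos : ∀ (x : X) (r : ℝ), 0 < r → 0 < m (ball x r))
    {u : X → ℝ} {K s ρ a : ℝ} {n : ℕ} (hK : 0 ≤ K) (ha : 0 < a) (hρ : 0 < ρ) (hρs : ρ ≤ s)
    (hu : ∀ y z, dist y z ≤ s → |u y - u z| ≤ K * dist y z) (hn : 4 * K ≤ 2 ^ n * a) :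
    ENNReal.ofReal ((a / 2) ^ 2) * (C ^ (n + 2))⁻¹ *
        m {x | ∃ y ∈ ball x (ρ / 2), a * (ρ / 2) < |u y - u x|} ≤
      ENNReal.ofReal (4 * ksEnergy m ρ u) := by
  have hc := continuous_of_locally_lipschitz (hρ.trans_le hρs) hu
  set E := {x | ∃ y ∈ ball x (ρ / 2), a * (ρ / 2) < |u y - u x|} with hE
  have hEo : IsOpen E := by
    have : E = ⋃ y, {x | dist y x < ρ / 2} ∩ {x | a * (ρ / 2) < |u y - u x|} := by
      ext x; simp [hE]
    rw [this]
    exact isOpen_iUnion fun y => (isOpen_lt (by fun_prop) (by fun_prop)).inter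
      (isOpen_lt (by fun_prop) (by fun_prop))
  have hCn : C ^ (n + 2) ≠ ∞ := by finiteness
  have hI : ∀ x ∈ E, ENNReal.ofReal ((a / 4) ^ 2) * (C ^ (n + 2))⁻¹ ≤ (m (ball x ρ))⁻¹ *
      ∫⁻ y in ball x ρ, ENNReal.ofReal ((u y - u x) ^ 2 / ρ ^ 2) ∂m := by
    rintro x ⟨y, hy, hyx⟩
    rw [mem_ball] at hy
    set t := ρ / 2 ^ (n + 1) with ht
    have htpos : 0 < t := by positivity
    have htρ : 2 ^ (n + 1) * t = ρ := by rw [ht]; field_simp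
    have ht2 : t ≤ ρ / 2 := by
      have : (1 : ℝ) ≤ 2 ^ n := one_le_pow₀ one_le_two
      rw [← htρ, pow_succ]; nlinarith
    have hsub : ball y t ⊆ ball x ρ := ball_subset_ball' (by linarith)
    have hm := measure_ball_le_of_le h (n + 2) x y (R := ρ) htpos
      (by rw [dist_comm, pow_succ]; nlinarith)
    have hlow : ∀ z ∈ ball y t, (a / 4) ^ 2 ≤ (u z - u x) ^ 2 / ρ ^ 2 := by
      intro z hz
      rw [mem_ball] at hz
      have h1 := hu z y (by linarith)
      have h2 : K * dist z y ≤ a * ρ / 8 := by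
        calc K * dist z y ≤ K * t := by gcongr
          _ ≤ (2 ^ n * a / 4) * t := by gcongr; linarith
          _ = a * ρ / 8 := by rw [← htρ]; ring
      rw [le_div_iff₀ (by positivity), ← mul_pow, ← sq_abs (u z - u x)]
      have h3 : |u y - u x| ≤ |u z - u y| + |u z - u x| := by
        have := abs_sub_le (u y) (u z) (u x); rwa [abs_sub_comm (u y) (u z)] at this
      gcongr
      nlinarith
    calc ENNReal.ofReal ((a / 4) ^ 2) * (C ^ (n + 2))⁻¹
        ≤ ENNReal.ofReal ((a / 4) ^ 2) * ((m (ball x ρ))⁻¹ * m (ball y t)) := by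
          gcongr
          rw [ENNReal.inv_le_iff_le_mul (fun h => absurd h
              (ENNReal.mul_ne_top (ENNReal.inv_ne_top.2 (hpos x ρ hρ).ne') (measure_ne_top _ _)))
            (fun _ => ?_)]
          · calc (1 : ℝ≥0∞) = (m (ball x ρ))⁻¹ * m (ball x ρ) :=
                (ENNReal.inv_mul_cancel (hpos x ρ hρ).ne' (measure_ne_top _ _)).symm
              _ ≤ (m (ball x ρ))⁻¹ * (C ^ (n + 2) * m (ball y t)) := by gcongr
              _ = _ := by ring
          · exact mul_ne_zero (ENNReal.inv_ne_zero.2 (measure_ne_top _ _)) (hpos y t htpos).ne'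
      _ = (m (ball x ρ))⁻¹ * ∫⁻ _ in ball y t, ENNReal.ofReal ((a / 4) ^ 2) ∂m := by
          rw [setLIntegral_const]; ring
      _ ≤ (m (ball x ρ))⁻¹ * ∫⁻ z in ball y t, ENNReal.ofReal ((u z - u x) ^ 2 / ρ ^ 2) ∂m := by
          refine mul_le_mul_right ?_ _
          exact setLIntegral_mono' measurableSet_ball fun z hz =>
            ENNReal.ofReal_le_ofReal (hlow z hz)
      _ ≤ _ := by gcongr
  have hen : ENNReal.ofReal (ksEnergy m ρ u) = ∫⁻ x, (m (ball x ρ))⁻¹ *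
      ∫⁻ y in ball x ρ, ENNReal.ofReal ((u y - u x) ^ 2 / ρ ^ 2) ∂m ∂m := by
    rw [ksEnergy, ofReal_integral_eq_lintegral_ofReal (integrable_sq_div_sq hρ hρs hu)
      (Eventually.of_forall fun p => by positivity), lintegral_ballPairMeasure ρ
      (by fun_prop)]
  rw [ENNReal.ofReal_mul (by norm_num), hen]
  calc _ = ENNReal.ofReal 4 * ∫⁻ _ in E, ENNReal.ofReal ((a / 4) ^ 2) * (C ^ (n + 2))⁻¹ ∂m := by
        rw [setLIntegral_const, show (a / 2) ^ 2 = 4 * (a / 4) ^ 2 by ring,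
          ENNReal.ofReal_mul (by norm_num)]
        ring
    _ ≤ _ := by
        refine mul_le_mul_right ?_ _
        exact (setLIntegral_mono' hEo.measurableSet hI).trans (setLIntegral_le_lintegral _ _)

end Energy

section Average

variable {X : Type*} [MeasurableSpace X] {m : Measure X} [IsFiniteMeasure m]

theorem abs_sub_le_average {u : X → ℝ} {W V : Set X} {p : X} {c δ A : ℝ} (hVW : V ⊆ W)
    (hV : 0 < m V) (hVm : MeasurableSet V) (hA : m.real W ≤ A * m.real V)
    (hδ : ∀ z ∈ V, |u z - u p| ≤ δ) (hInt : IntegrableOn (fun z => |u z - c|) W m) :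
    |u p - c| ≤ δ + A * ⨍ z in W, |u z - c| ∂m := by
  have hV' : 0 < m.real V := ENNReal.toReal_pos hV.ne' (measure_ne_top _ _)
  have hW' : 0 < m.real W := hV'.trans_le (measureReal_mono hVW)
  have h1 : m.real V * (|u p - c| - δ) ≤ ∫ z in V, |u z - c| ∂m := by
    rw [← smul_eq_mul, ← setIntegral_const]
    refine setIntegral_mono_on (integrableOn_const (measure_ne_top _ _)) (hInt.mono_set hVW) hVm
      fun z hz => ?_
    have h2 := abs_sub_le (u p) (u z) c
    have h3 := hδ z hz
    rw [abs_sub_comm (u p) (u z)] at h2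
    linarith
  have h2 : ∫ z in V, |u z - c| ∂m ≤ ∫ z in W, |u z - c| ∂m :=
    setIntegral_mono_set hInt (Eventually.of_forall fun _ => abs_nonneg _)
      (LE.le.eventuallyLE hVW)
  have h3 : ∫ z in W, |u z - c| ∂m = m.real W * ⨍ z in W, |u z - c| ∂m := by
    rw [setAverage_eq, smul_eq_mul]
    field_simp
  have h4 : 0 ≤ ⨍ z in W, |u z - c| ∂m := by
    rw [setAverage_eq, smul_eq_mul]
    exact mul_nonneg (by positivity) (integral_nonneg fun _ => abs_nonneg _)
  have h5 : m.real V * (|u p - c| - δ) ≤ m.real V * (A * ⨍ z in W, |u z - c| ∂m) := by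
    refine (h1.trans h2).trans (h3.le.trans ?_)
    nlinarith
  linarith [le_of_mul_le_mul_left h5 hV']

/-- The square average of `a + K * 1_B` over a set in which `B` has small density. -/
theorem sqrt_average_sq_add_indicator_le {B W : Set X} {a K c : ℝ} (ha : 0 ≤ a)
    (hB : MeasurableSet B) (hW : 0 < m W) (hc : (a + K) ^ 2 * c ≤ a ^ 2)
    (hBW : m.real (B ∩ W) ≤ c * m.real W) :
    Real.sqrt (⨍ y in W, (a + B.indicator (fun _ => K) y) ^ 2 ∂m) ≤ 2 * a := by
  have hW' : 0 < m.real W := ENNReal.toReal_pos hW.ne' (measure_ne_top _ _)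
  have hle : ∀ y, (a + B.indicator (fun _ => K) y) ^ 2 ≤
      a ^ 2 + B.indicator (fun _ => (a + K) ^ 2) y := by
    intro y
    by_cases hy : y ∈ B
    · simp only [Set.indicator_of_mem hy]
      nlinarith [sq_nonneg a]
    · simp [Set.indicator_of_notMem hy]
  have hi : Integrable (fun y => a ^ 2 + B.indicator (fun _ => (a + K) ^ 2) y) (m.restrict W) :=
    (integrable_const _).add ((integrable_const _).indicator hB)
  have h1 : ∫ y in W, (a + B.indicator (fun _ => K) y) ^ 2 ∂m ≤ 2 * a ^ 2 * m.real W := by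
    calc _ ≤ ∫ y in W, a ^ 2 + B.indicator (fun _ => (a + K) ^ 2) y ∂m :=
          integral_mono_of_nonneg (Eventually.of_forall fun _ => sq_nonneg _) hi
            (Eventually.of_forall hle)
      _ = a ^ 2 * m.real W + (a + K) ^ 2 * m.real (B ∩ W) := by
          rw [integral_add (integrable_const _) ((integrable_const _).indicator hB),
            integral_indicator_const _ hB, setIntegral_const, smul_eq_mul, smul_eq_mul,
            measureReal_restrict_apply hB]
          ring
      _ ≤ a ^ 2 * m.real W + (a + K) ^ 2 * (c * m.real W) := by gcongr
      _ = (a ^ 2 + (a + K) ^ 2 * c) * m.real W := by ring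
      _ ≤ (a ^ 2 + a ^ 2) * m.real W := by gcongr
      _ = _ := by ring
  refine Real.sqrt_le_iff.2 ⟨by positivity, ?_⟩
  rw [setAverage_eq, smul_eq_mul, inv_mul_le_iff₀ hW']
  nlinarith [mul_nonneg (sq_nonneg a) hW'.le]

end Average

section Oscillation

variable {X : Type*} [MetricSpace X] [MeasurableSpace X] [BorelSpace X] {m : Measure X}
  [IsFiniteMeasure m]

theorem exists_isOpen_frequently_oscillation_le [SecondCountableTopology X] {C : ℝ≥0∞}
    (h : ∀ (x : X) (r : ℝ), 0 < r → m (ball x (2 * r)) ≤ C * m (ball x r)) (hC : C ≠ ∞)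
    (hpos : ∀ (x : X) (r : ℝ), 0 < r → 0 < m (ball x r))
    {u : X → ℝ} {K s a ε : ℝ} {n : ℕ} {δ : ℝ≥0∞} (hK : 0 ≤ K) (ha : 0 < a) (hs : 0 < s)
    (hu : ∀ y z, dist y z ≤ s → |u y - u z| ≤ K * dist y z) (hn : 4 * K ≤ 2 ^ n * a)
    (hε : ∃ᶠ i : ℕ in atTop, ksEnergy m ((1 / 2) ^ i) u < ε)
    (hδ : ENNReal.ofReal (4 * ε) < ENNReal.ofReal ((a / 2) ^ 2) * (C ^ (n + 2))⁻¹ * δ) :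
    ∃ B, IsOpen B ∧ m B < δ ∧
      ∀ x ∉ B, ∃ᶠ r in 𝓝[>] (0 : ℝ), ∀ y ∈ ball x r, |u y - u x| ≤ a * r := by
  set c := ENNReal.ofReal ((a / 2) ^ 2) * (C ^ (n + 2))⁻¹ with hc
  have hρ0 : Tendsto (fun i : ℕ => ((1 : ℝ) / 2) ^ i) atTop (𝓝 0) :=
    tendsto_pow_atTop_nhds_zero_of_lt_one (by norm_num) (by norm_num)
  have hr0 : Tendsto (fun i : ℕ => ((1 : ℝ) / 2) ^ i / 2) atTop (𝓝[>] 0) := by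
    refine tendsto_nhdsWithin_iff.2 ⟨by simpa using hρ0.div_const 2, ?_⟩
    exact Eventually.of_forall fun i => Set.mem_Ioi.2 (by positivity)
  have hsmall : ∀ᶠ i : ℕ in atTop, ((1 : ℝ) / 2) ^ i ≤ s :=
    (hρ0.eventually (gt_mem_nhds hs)).mono fun _ hi => hi.le
  let S : ℕ → Set X := fun i =>
    {x | ∃ y ∈ ball x ((1 / 2) ^ i / 2), a * ((1 / 2) ^ i / 2) < |u y - u x|}
  let T : ℕ → Set X := fun N => {x | ∀ i, N ≤ i → x ∈ S i}
  have hT : Monotone T := fun N N' hN x hx i hi => hx i (hN.trans hi)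
  have hbad : {x | ¬ ∃ᶠ r in 𝓝[>] (0 : ℝ), ∀ y ∈ ball x r, |u y - u x| ≤ a * r} ⊆ ⋃ N, T N := by
    intro x hx
    rw [Set.mem_ofPred_eq, not_frequently] at hx
    obtain ⟨N, hN⟩ := eventually_atTop.1 (hr0.eventually hx)
    refine Set.mem_iUnion.2 ⟨N, fun i hi => ?_⟩
    have := hN i hi
    push Not at this
    exact this
  have hTm : c * m (⋃ N, T N) ≤ ENNReal.ofReal (4 * ε) := by
    rw [hT.measure_iUnion, ENNReal.mul_iSup]
    refine iSup_le fun N => ?_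
    obtain ⟨i, hi, hiN, his⟩ := (hε.and_eventually ((eventually_ge_atTop N).and hsmall)).exists
    calc c * m (T N) ≤ c * m (S i) := by
          gcongr
          exact fun x hx => hx i hiN
      _ ≤ ENNReal.ofReal (4 * ksEnergy m ((1 / 2) ^ i) u) :=
          mul_measure_oscillation_le h hC hpos hK ha (by positivity) his hu hn
      _ ≤ ENNReal.ofReal (4 * ε) := by gcongr
  obtain ⟨B, hTB, hB, hBδ⟩ := (⋃ N, T N).exists_isOpen_lt_of_lt δ
    (lt_of_mul_lt_mul_left' (hTm.trans_lt hδ))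
  refine ⟨B, hB, hBδ, fun x hx => ?_⟩
  by_contra hx'
  exact hx (hTB (hbad hx'))

theorem abs_sub_le_of_poincare {C : ℝ≥0∞}
    (h : ∀ (x : X) (r : ℝ), 0 < r → m (ball x (2 * r)) ≤ C * m (ball x r)) (hC : C ≠ ∞)
    (hpos : ∀ (x : X) (r : ℝ), 0 < r → 0 < m (ball x r)) {u : X → ℝ} {K D a c r t σ Λ P : ℝ}
    {n : ℕ} {B : Set X} {x y : X}
    (hP : ∀ (f g : X → ℝ) (x : X) (r : ℝ),
      Measurable f → IsUpperGradientWrt dist f g → 0 < r → r < 1 →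
      ⨍ y in Metric.ball x r, |f y - ⨍ z in Metric.ball x r, f z ∂m| ∂m ≤
        P * r * Real.sqrt (⨍ y in Metric.ball x (Λ * r), (g y) ^ 2 ∂m))
    (hP0 : 0 ≤ P) (hΛ : 0 < Λ) (ha : 0 ≤ a)
    (hcont : Continuous u) (hD : ∀ z ∈ ball x (2 * r), |u z - u x| ≤ D) (hB : MeasurableSet B)
    (hg : IsUpperGradientWrt dist u fun x => a + B.indicator (fun _ => K) x)
    (hr : 0 < r) (hr1 : 2 * r < 1) (hxy : dist x y = r) (ht : 0 < t)
    (htr : t ≤ r) (hnt : 3 * r ≤ 2 ^ n * t) (hx : ∀ z ∈ ball x t, |u z - u x| ≤ σ * r)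
    (hy : ∀ z ∈ ball y t, |u z - u y| ≤ σ * r) (hc : (a + K) ^ 2 * c ≤ a ^ 2)
    (hσ : 8 * C.toReal ^ n * P * a ≤ σ)
    (hBc : m.real (B ∩ ball x (Λ * (2 * r))) ≤ c * m.real (ball x (Λ * (2 * r)))) :
    |u x - u y| ≤ 3 * σ * r := by
  have hsq := sqrt_average_sq_add_indicator_le ha hB (hpos x (Λ * (2 * r)) (by positivity)) hc
    hBc
  have hav := hP u _ x (2 * r) hcont.measurable hg (by positivity) hr1
  set c₀ := ⨍ z in ball x (2 * r), u z ∂m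
  have hInt : IntegrableOn (fun z => |u z - c₀|) (ball x (2 * r)) m := by
    refine Integrable.of_bound (C := D + |u x - c₀|) (by fun_prop) ?_
    filter_upwards [ae_restrict_mem measurableSet_ball] with z hz
    rw [Real.norm_eq_abs, abs_abs]
    linarith [abs_sub_le (u z) (u x) c₀, hD z hz]
  have hA : ∀ p, dist x p ≤ r →
      m.real (ball x (2 * r)) ≤ C.toReal ^ n * m.real (ball p t) := by
    intro p hp
    rw [Measure.real, Measure.real, ← ENNReal.toReal_pow, ← ENNReal.toReal_mul]
    exact ENNReal.toReal_mono (by finiteness) (measure_ball_le_of_le h n x p ht (by linarith))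
  have h1 := abs_sub_le_average (c := c₀) (ball_subset_ball (by linarith)) (hpos x t ht)
    measurableSet_ball (hA x (by simpa using hr.le)) hx hInt
  have h2 := abs_sub_le_average (c := c₀)
    (ball_subset_ball' (by rw [dist_comm, hxy]; linarith)) (hpos y t ht)
    measurableSet_ball (hA y hxy.le) hy hInt
  have h3 : C.toReal ^ n * ⨍ z in ball x (2 * r), |u z - c₀| ∂m ≤ σ / 2 * r := by
    calc C.toReal ^ n * ⨍ z in ball x (2 * r), |u z - c₀| ∂m
        ≤ C.toReal ^ n * (P * (2 * r) * (2 * a)) := by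
          gcongr
          exact hav.trans (by gcongr)
      _ = (8 * C.toReal ^ n * P * a) / 2 * r := by ring
      _ ≤ σ / 2 * r := by gcongr
  have h4 := abs_sub_le (u x) c₀ (u y)
  rw [abs_sub_comm c₀] at h4
  linarith

end Oscillation

section FlatScales

variable {X : Type*} [MetricSpace X] [MeasurableSpace X] [BorelSpace X] {m : Measure X}
  [IsFiniteMeasure m]

/-- An Egorov-type statement: up to a set of small measure, the scales at which `f` has small
oscillation can be chosen uniformly bounded from below. -/
theorem exists_uniform_scales {f : X → ℝ} (hf : Continuous f) {K a a₁ a₂ : ℝ} (hK : 0 < K)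
    (ha : 0 ≤ a) (ha₁ : a < a₁) (ha₂ : a₁ < a₂) {δ : ℝ≥0∞} (hδ : δ ≠ 0) :
    ∃ M : Set X,
      m ({x | ∃ᶠ r in 𝓝[>] (0 : ℝ), ∀ y ∈ ball x r, |f y - f x| ≤ a * r} \ M) < δ ∧
      ∀ k : ℕ, ∃ s, 0 < s ∧ K * s ≤ 1 / ((k : ℝ) + 1) ∧ ∀ x ∈ M, ∃ r, 0 < r ∧
        r ≤ 1 / ((k : ℝ) + 1) ∧ 2 * K * s ≤ (a₂ - a₁) * r ∧
        ∀ y ∈ ball x r, |f y - f x| ≤ a₁ * r := by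
  let M : ℕ → ℕ → Set X := fun n j => ⋃ q : ℚ, {x | 0 < (q : ℝ) ∧ (q : ℝ) ≤ 1 / ((n : ℝ) + 1) ∧
    2 * K * (1 / ((j : ℝ) + 1)) ≤ (a₂ - a₁) * q ∧ ∀ y ∈ ball x q, |f y - f x| ≤ a₁ * q}
  have hMm : ∀ n j, MeasurableSet (M n j) := by
    intro n j
    refine MeasurableSet.iUnion fun q => ?_
    refine (MeasurableSet.const _).inter ((MeasurableSet.const _).inter
      ((MeasurableSet.const _).inter ?_))
    have : {x | ∀ y ∈ ball x (q : ℝ), |f y - f x| ≤ a₁ * q} =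
        ⋂ y, {x | (q : ℝ) ≤ dist y x} ∪ {x | |f y - f x| ≤ a₁ * q} := by
      ext x
      simp only [mem_ball, Set.mem_ofPred_eq, Set.mem_iInter, Set.mem_union, ← not_lt (b := (q : ℝ)),
        ← imp_iff_not_or]
    have hcl : IsClosed {x | ∀ y ∈ ball x (q : ℝ), |f y - f x| ≤ a₁ * q} := by
      rw [this]
      exact isClosed_iInter fun y => (isClosed_le (by fun_prop) (by fun_prop)).union
        (isClosed_le (by fun_prop) (by fun_prop))
    exact hcl.measurableSet
  have hmono : ∀ n, Monotone (M n) := by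
    intro n j j' hj x hx
    obtain ⟨q, h1, h2, h3, h4⟩ := Set.mem_iUnion.1 hx
    refine Set.mem_iUnion.2 ⟨q, h1, h2, le_trans ?_ h3, h4⟩
    gcongr
  have hsub : ∀ n, {x | ∃ᶠ r in 𝓝[>] (0 : ℝ), ∀ y ∈ ball x r, |f y - f x| ≤ a * r} ⊆
      ⋃ j, M n j := by
    intro n x hx
    have ha₁' : 0 < a₁ := ha.trans_lt ha₁
    obtain ⟨r, hr, hr0, hr1⟩ := (hx.and_eventually (Ioo_mem_nhdsGT
      (show (0 : ℝ) < 1 / ((n : ℝ) + 1) by positivity))).exists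
    have hlt : a * r / a₁ < r := by
      rw [div_lt_iff₀ ha₁']; nlinarith
    obtain ⟨q, hq1, hq2⟩ := exists_rat_btwn hlt
    rw [div_lt_iff₀ ha₁'] at hq1
    have hq0 : 0 < (q : ℝ) := by
      by_contra! h
      nlinarith [mul_nonneg ha hr0.le]
    obtain ⟨j, hj⟩ := exists_nat_one_div_lt
      (show 0 < (a₂ - a₁) * q / (2 * K) from div_pos (mul_pos (by linarith) hq0) (by positivity))
    refine Set.mem_iUnion.2 ⟨j, Set.mem_iUnion.2 ⟨q, hq0, hq2.le.trans hr1.le, ?_, ?_⟩⟩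
    · rw [lt_div_iff₀ (by positivity)] at hj
      linarith
    · intro y hy
      exact (hr y (ball_subset_ball hq2.le hy)).trans (by linarith)
  obtain ⟨ε, hε0, hε⟩ := ENNReal.exists_pos_sum_of_countable' hδ ℕ
  have hj : ∀ n, ∃ j : ℕ, m ((⋃ j, M n j) \ M n j) < ε n ∧ K * (1 / ((j : ℝ) + 1)) ≤
      1 / ((n : ℝ) + 1) := by
    intro n
    have h1 : Tendsto (fun j => m ((⋃ j, M n j) \ M n j)) atTop (𝓝 0) := by
      have := tendsto_measure_iInter_atTop (μ := m) (s := fun j => (⋃ j, M n j) \ M n j)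
        (fun j => ((MeasurableSet.iUnion (hMm n)).diff (hMm n j)).nullMeasurableSet)
        (fun j j' hjj => Set.sdiff_subset_sdiff_right (hmono n hjj)) ⟨0, measure_ne_top _ _⟩
      rwa [← Set.sdiff_iUnion, Set.sdiff_self, measure_empty] at this
    have h2 : Tendsto (fun j : ℕ => K * (1 / ((j : ℝ) + 1))) atTop (𝓝 0) := by
      simpa using tendsto_one_div_add_atTop_nhds_zero_nat.const_mul K
    obtain ⟨j, h3, h4⟩ := ((h1.eventually (gt_mem_nhds (hε0 n))).and (h2.eventually
      (gt_mem_nhds (show (0 : ℝ) < 1 / ((n : ℝ) + 1) by positivity)))).exists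
    exact ⟨j, h3, h4.le⟩
  choose j hjm hjK using hj
  refine ⟨⋂ n, M n (j n), ?_, fun k => ⟨1 / ((j k : ℝ) + 1), by positivity, hjK k, ?_⟩⟩
  · rw [Set.sdiff_iInter]
    refine (measure_iUnion_le _).trans_lt (lt_of_le_of_lt ?_ hε)
    exact ENNReal.tsum_le_tsum fun n =>
      (measure_mono (Set.sdiff_subset_sdiff_left (hsub n))).trans (hjm n).le
  · intro x hx
    obtain ⟨q, h1, h2, h3, h4⟩ := Set.mem_iUnion.1 (Set.mem_iInter.1 hx k)
    exact ⟨q, h1, h2, h3, h4⟩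

/-- Approximations of `f` with small slope on `M`, some of which are close in energy. -/
theorem exists_approx_ksEnergy_lt [SecondCountableTopology X] {f : X → ℝ} {K a₁ a₂ : ℝ}
    {M : Set X} (hf : ∀ y z, |f y - f z| ≤ K * dist y z) (hK : 0 ≤ K) (ha₁ : 0 ≤ a₁)
    (ha₂ : a₁ ≤ a₂) (haK : a₂ ≤ K)
    (hM : ∀ k : ℕ, ∃ s, 0 < s ∧ K * s ≤ 1 / ((k : ℝ) + 1) ∧ ∀ x ∈ M, ∃ r, 0 < r ∧
      r ≤ 1 / ((k : ℝ) + 1) ∧ 2 * K * s ≤ (a₂ - a₁) * r ∧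
      ∀ y ∈ ball x r, |f y - f x| ≤ a₁ * r)
    {ε : ℝ} (hε : 0 < ε) :
    ∃ (A : X → ℝ) (s : ℝ), 0 < s ∧ (∀ y z, dist y z ≤ s → |A y - A z| ≤ K * dist y z) ∧
      (∀ y ∈ M, ∀ z, dist y z ≤ s → |A y - A z| ≤ a₂ * dist y z) ∧
      ∀ k : ℕ, ∃ (A' : X → ℝ) (s' : ℝ), 0 < s' ∧
        (∀ y z, dist y z ≤ s' → |A' y - A' z| ≤ K * dist y z) ∧
        (∀ y, |A' y - f y| ≤ (1 + a₁) / ((k : ℝ) + 1)) ∧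
        ∃ᶠ i : ℕ in atTop, ksEnergy m ((1 / 2) ^ i) (A - A') < ε := by
  let U : ℕ → Set (X → ℝ) := fun k => {u | ∃ s, 0 < s ∧
    (∀ y z, dist y z ≤ s → |u y - u z| ≤ K * dist y z) ∧
    (∀ y ∈ M, ∀ z, dist y z ≤ s → |u y - u z| ≤ a₂ * dist y z) ∧
    ∀ y, |u y - f y| ≤ (1 + a₁) / ((k : ℝ) + 1)}
  have hsmall : ∀ s : ℝ, 0 < s → ∀ᶠ i : ℕ in atTop, ((1 : ℝ) / 2) ^ i ≤ s := fun s hs =>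
    ((tendsto_pow_atTop_nhds_zero_of_lt_one (by norm_num) (by norm_num)).eventually
      (gt_mem_nhds hs)).mono fun _ hi => hi.le
  have hanti : Antitone U := by
    rintro k k' hk u ⟨s, hs, h1, h2, h3⟩
    refine ⟨s, hs, h1, h2, fun y => (h3 y).trans ?_⟩
    gcongr
  have hne : ∀ k, (U k).Nonempty := by
    intro k
    obtain ⟨s, hs, hKs, hr⟩ := hM k
    choose! r hr0 hrk hrs hosc using hr
    obtain ⟨u, h1, h2, h3⟩ := exists_approx_of_oscillation (r := r) hf hK ha₁ (ha₁.trans ha₂) haK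
      hs.le (show (0 : ℝ) ≤ 1 / ((k : ℝ) + 1) by positivity) hr0 hrk hrs hosc
    refine ⟨u, s, hs, h2, h3, fun y => (h1 y).trans ?_⟩
    calc K * s + a₁ * (1 / ((k : ℝ) + 1)) ≤ 1 / ((k : ℝ) + 1) + a₁ * (1 / ((k : ℝ) + 1)) := by gcongr
      _ = _ := by ring
  have hmid : ∀ k, ∀ u ∈ U k, ∀ v ∈ U k, (1 / 2 : ℝ) • (u + v) ∈ U k := by
    rintro k u ⟨s, hs, hu1, hu2, hu3⟩ v ⟨s', hs', hv1, hv2, hv3⟩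
    have haux : ∀ p q p' q' c : ℝ, |p - p'| ≤ c → |q - q'| ≤ c →
        |1 / 2 * (p + q) - 1 / 2 * (p' + q')| ≤ c := by
      intro p q p' q' c h1 h2
      rw [abs_le] at *
      constructor <;> linarith
    refine ⟨min s s', lt_min hs hs', fun y z hyz => ?_, fun y hy z hyz => ?_, fun y => ?_⟩
    · exact haux _ _ _ _ _ (hu1 y z (hyz.trans (min_le_left _ _)))
        (hv1 y z (hyz.trans (min_le_right _ _)))
    · exact haux _ _ _ _ _ (hu2 y hy z (hyz.trans (min_le_left _ _)))
        (hv2 y hy z (hyz.trans (min_le_right _ _)))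
    · have := haux _ _ _ _ _ (hu3 y) (hv3 y)
      rwa [show 1 / 2 * (f y + f y) = f y by ring] at this
  obtain ⟨A, ⟨s, hs, hA1, hA2, -⟩, hA⟩ := exists_frequently_lt_of_parallelogram
    (Q := fun i : ℕ => ksEnergy m ((1 / 2) ^ i)) (c := K ^ 2 * m.real Set.univ) hanti hne hmid
    (fun i u => ksEnergy_nonneg m _ u)
    (by
      rintro u ⟨s, hs, hu, -⟩
      filter_upwards [hsmall s hs] with i hi
      exact ksEnergy_le (by positivity) hi hu)
    (by
      rintro u ⟨s, hs, hu, -⟩ v ⟨s', hs', hv, -⟩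
      filter_upwards [hsmall s hs, hsmall s' hs'] with i hi hi'
      exact ksEnergy_parallelogram (by positivity) le_rfl
        (fun y z h => hu y z (h.trans hi)) (fun y z h => hv y z (h.trans hi'))) hε
  refine ⟨A, s, hs, hA1, hA2, fun k => ?_⟩
  obtain ⟨A', ⟨s', hs', hA1', -, hA3'⟩, hAA'⟩ := hA k
  exact ⟨A', s', hs', hA1', hA3', hAA'⟩

end FlatScales

section SlopeGap

variable {X : Type*} [MetricSpace X] [MeasurableSpace X] [BorelSpace X] {m : Measure X}
  [IsFiniteMeasure m]

/-- If `A` has slope at most `a` at `x` while `A'` is uniformly close to a function `f` whose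
increment from `x` to `y` is at least `b * dist x y`, then the exceptional set for the upper gradient
of `A - A'` has definite density around `x`. -/
theorem le_measure_inter_of_slope_gap {C : ℝ≥0∞}
    (h : ∀ (x : X) (r : ℝ), 0 < r → m (ball x (2 * r)) ≤ C * m (ball x r)) (hC : C ≠ ∞)
    (hpos : ∀ (x : X) (r : ℝ), 0 < r → 0 < m (ball x r)) {f A A' : X → ℝ}
    {K a b a₀ c η r s σ Λ P : ℝ} {n : ℕ} {B : Set X} {x y : X}
    (hP : ∀ (f g : X → ℝ) (x : X) (r : ℝ),
      Measurable f → IsUpperGradientWrt dist f g → 0 < r → r < 1 →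
      ⨍ y in Metric.ball x r, |f y - ⨍ z in Metric.ball x r, f z ∂m| ∂m ≤
        P * r * Real.sqrt (⨍ y in Metric.ball x (Λ * r), (g y) ^ 2 ∂m))
    (hP0 : 0 ≤ P) (hΛ : 0 < Λ) (hK : 0 ≤ K) (ha₀ : 0 ≤ a₀)
    (hf : ∀ y z, |f y - f z| ≤ K * dist y z)
    (hA : ∀ y z, dist y z ≤ s → |A y - A z| ≤ K * dist y z)
    (hAx : ∀ z, dist x z ≤ s → |A x - A z| ≤ a * dist x z)
    (hA' : ∀ z, |A' z - f z| ≤ η) (hcont : Continuous (A - A')) (hB : MeasurableSet B)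
    (hg : IsUpperGradientWrt dist (A - A') fun x => a₀ + B.indicator (fun _ => 2 * K) x)
    (hr : 0 < r) (hr1 : 2 * r < 1) (hrs : 2 * r ≤ s) (hxy : dist x y = r)
    (hfxy : b * r < |f y - f x|) (hησ : 4 * η ≤ σ * r) (hσb : 4 * σ ≤ b - a)
    (hnσ : 12 * K + 4 * σ ≤ 2 ^ n * σ) (hσ : 0 < σ) (hc : (a₀ + 2 * K) ^ 2 * c ≤ a₀ ^ 2)
    (ha₀σ : 8 * C.toReal ^ n * P * a₀ ≤ σ) :
    ENNReal.ofReal c * m (ball x (Λ * (2 * r))) ≤ m (B ∩ ball x (Λ * (2 * r))) := by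
  by_contra! hlt
  set W := ball x (Λ * (2 * r)) with hW
  have hc0 : 0 ≤ c := by
    by_contra! hc0
    rw [ENNReal.ofReal_of_nonpos hc0.le, zero_mul] at hlt
    exact not_lt_bot hlt
  have hBc : m.real (B ∩ W) ≤ c * m.real W := by
    have := ENNReal.toReal_mono (by finiteness) hlt.le
    rwa [ENNReal.toReal_mul, ENNReal.toReal_ofReal hc0] at this
  have h4n : (4 : ℝ) ≤ 2 ^ n := by
    by_contra! h4
    nlinarith
  set t := 3 * r / 2 ^ n with ht
  have htr : t ≤ r := by
    rw [ht, div_le_iff₀ (by positivity)]; nlinarith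
  have hKt : 2 * K * t ≤ σ / 2 * r := by
    have h1 : 2 ^ n * t = 3 * r := by rw [ht]; field_simp
    have h2 : 2 ^ n * (2 * K * t) ≤ 2 ^ n * (σ / 2 * r) := by
      nlinarith
    exact le_of_mul_le_mul_left h2 (by positivity)
  have ht0 : 0 < t := by positivity
  have hA'2 : ∀ y z, |A' y - A' z| ≤ |f y - f z| + 2 * η := by
    intro y z
    have h1 := abs_le.1 (hA' y)
    have h2 := abs_le.1 (hA' z)
    have h3 := abs_le.1 (le_refl |f y - f z|)
    rw [abs_le]
    constructor <;> linarith
  have hnear : ∀ p, ∀ z ∈ ball p t, |(A - A') z - (A - A') p| ≤ σ * r := by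
    intro p z hz
    rw [mem_ball] at hz
    have h1 := hA z p (by linarith)
    have h2 := hA'2 z p
    have h3 := hf z p
    have h4 : K * dist z p ≤ K * t := by gcongr
    have h5 := abs_sub (A z - A p) (A' z - A' p)
    simp only [Pi.sub_apply]
    rw [show A z - A' z - (A p - A' p) = (A z - A p) - (A' z - A' p) by ring]
    linarith
  have hD : ∀ z ∈ ball x (2 * r), |(A - A') z - (A - A') x| ≤ K * (2 * r) + K * (2 * r) + 2 * η := by
    intro z hz
    rw [mem_ball] at hz
    have h1 := hA z x (by linarith)
    have h2 := hA'2 z x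
    have h3 := hf z x
    have h4 : K * dist z x ≤ K * (2 * r) := by gcongr
    have h5 := abs_sub (A z - A x) (A' z - A' x)
    simp only [Pi.sub_apply]
    rw [show A z - A' z - (A x - A' x) = (A z - A x) - (A' z - A' x) by ring]
    linarith
  have key := abs_sub_le_of_poincare (n := n) (t := t) h hC hpos hP hP0 hΛ ha₀ hcont hD hB hg hr hr1 hxy
    ht0 htr (by rw [ht]; field_simp; rfl) (hnear x) (hnear y) hc ha₀σ hBc
  have h1 := hAx y (by rw [hxy]; linarith)
  rw [hxy] at h1
  have h2 : |f y - f x| ≤ |A' x - A' y| + 2 * η := by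
    have h1 := abs_le.1 (hA' y)
    have h2 := abs_le.1 (hA' x)
    have h3 := abs_le.1 (le_refl |A' x - A' y|)
    rw [abs_le]
    constructor <;> linarith
  have h3 : |A' x - A' y| ≤ |A x - A y| + |(A - A') x - (A - A') y| := by
    have h5 := abs_sub (A x - A y) ((A - A') x - (A - A') y)
    simp only [Pi.sub_apply] at h5 ⊢
    rwa [show A x - A y - (A x - A' x - (A y - A' y)) = A' x - A' y by ring] at h5
  have h4 : b * r < a * r + 3 * σ * r + σ / 2 * r := by linarith
  have h5 : r * (4 * σ) ≤ r * (b - a) := by gcongr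
  nlinarith

/-- Almost every point is not simultaneously one where `f` has small oscillation along a sequence
of scales and larger difference quotients along another sequence of points. -/
theorem measure_slope_gap_eq_zero [TopologicalSpace.SeparableSpace X] {C : ℝ≥0∞}
    (h : ∀ (x : X) (r : ℝ), 0 < r → m (ball x (2 * r)) ≤ C * m (ball x r)) (hC : C ≠ ∞)
    (hpos : ∀ (x : X) (r : ℝ), 0 < r → 0 < m (ball x r)) {Λ P : ℝ}
    (hP : ∀ (f g : X → ℝ) (x : X) (r : ℝ),
      Measurable f → IsUpperGradientWrt dist f g → 0 < r → r < 1 →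
      ⨍ y in Metric.ball x r, |f y - ⨍ z in Metric.ball x r, f z ∂m| ∂m ≤
        P * r * Real.sqrt (⨍ y in Metric.ball x (Λ * r), (g y) ^ 2 ∂m))
    (hP0 : 0 ≤ P) (hΛ : 0 < Λ) {f : X → ℝ} {K a b : ℝ}
    (hf : ∀ y z, |f y - f z| ≤ K * dist y z) (ha : 0 ≤ a) (hab : a < b) (hbK : b ≤ K) :
    m {x | (∃ᶠ r in 𝓝[>] (0 : ℝ), ∀ y ∈ ball x r, |f y - f x| ≤ a * r) ∧
      ∃ᶠ y in 𝓝[≠] x, b * dist y x < |f y - f x|} = 0 := by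
  have : SecondCountableTopology X := UniformSpace.secondCountable_of_separable X
  have hK : 0 < K := by linarith
  have hfc : Continuous f := continuous_of_locally_lipschitz zero_lt_one fun y z _ => hf y z
  set F := {x | ∃ᶠ r in 𝓝[>] (0 : ℝ), ∀ y ∈ ball x r, |f y - f x| ≤ a * r} with hF
  set G := {x | ∃ᶠ y in 𝓝[≠] x, b * dist y x < |f y - f x|} with hG
  change m (F ∩ G) = 0
  by_contra hne
  obtain ⟨a₁, ha₁, ha₁b⟩ := exists_between hab
  obtain ⟨a₂, ha₂, ha₂b⟩ := exists_between ha₁b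
  obtain ⟨M, hMδ, hM⟩ := exists_uniform_scales (m := m) hfc hK ha ha₁ ha₂ hne
  set T := G ∩ M with hT
  have hTpos : m T ≠ 0 := by
    intro h0
    have h1 : F ∩ G ⊆ T ∪ (F \ M) := fun x hx => by
      by_cases hxM : x ∈ M
      · exact Or.inl ⟨hx.2, hxM⟩
      · exact Or.inr ⟨hx.1, hxM⟩
    have h2 := (measure_mono h1).trans (measure_union_le (μ := m) T (F \ M))
    rw [h0, zero_add] at h2
    exact absurd hMδ (not_lt.2 h2)
  -- the constants
  set σ := (b - a₂) / 4 with hσ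
  have hσ0 : 0 < σ := by rw [hσ]; linarith
  obtain ⟨n, hn⟩ := pow_unbounded_of_one_lt ((12 * K + 4 * σ) / σ) (one_lt_two (α := ℝ))
  rw [div_lt_iff₀ hσ0] at hn
  set D := 8 * C.toReal ^ n * P with hD
  have hD0 : 0 ≤ D := by positivity
  set a₀ := σ / (D + 1) with ha₀
  have ha₀0 : 0 < a₀ := by positivity
  have ha₀σ : D * a₀ ≤ σ := by
    rw [ha₀, mul_div_assoc', div_le_iff₀ (by positivity)]
    nlinarith
  set c := a₀ ^ 2 / (a₀ + 2 * K) ^ 2 with hc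
  have hc0 : 0 < c := by positivity
  have hc' : (a₀ + 2 * K) ^ 2 * c ≤ a₀ ^ 2 := by
    rw [hc]; field_simp; rfl
  obtain ⟨n', hn'⟩ := pow_unbounded_of_one_lt (4 * (2 * K) / a₀) (one_lt_two (α := ℝ))
  rw [div_lt_iff₀ ha₀0] at hn'
  set δ := ENNReal.ofReal c * (m T / 2) * (C ^ 3)⁻¹ with hδ
  have hC3 : C ^ 3 ≠ ∞ := by finiteness
  have hδ0 : δ ≠ 0 := by
    refine mul_ne_zero (mul_ne_zero (ENNReal.ofReal_pos.2 hc0).ne' ?_) (ENNReal.inv_ne_zero.2 hC3)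
    simpa using hTpos
  obtain ⟨ε, hε0, hε⟩ : ∃ ε : ℝ, 0 < ε ∧
      ENNReal.ofReal (4 * ε) < ENNReal.ofReal ((a₀ / 2) ^ 2) * (C ^ (n' + 2))⁻¹ * δ := by
    have h1 : 0 < ENNReal.ofReal ((a₀ / 2) ^ 2) * (C ^ (n' + 2))⁻¹ * δ := by
      refine pos_iff_ne_zero.2 (mul_ne_zero (mul_ne_zero ?_ ?_) hδ0)
      · exact (ENNReal.ofReal_pos.2 (by positivity)).ne'
      · exact ENNReal.inv_ne_zero.2 (by finiteness)
    obtain ⟨q, hq0, hq⟩ := exists_between h1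
    have hq' := hq.ne_top
    refine ⟨q.toReal / 4, div_pos (ENNReal.toReal_pos hq0.ne' hq') (by norm_num), ?_⟩
    rwa [mul_div_cancel₀ _ (by norm_num : (4 : ℝ) ≠ 0), ENNReal.ofReal_toReal hq']
  obtain ⟨A, s, hs, hA1, hA2, hA⟩ := exists_approx_ksEnergy_lt (m := m) hf hK.le (ha.trans ha₁.le)
    ha₂.le (ha₂b.le.trans hbK) hM hε0
  -- a good increment around each point
  have hy : ∀ x ∈ T, ∃ y, 0 < dist x y ∧ dist x y < min (s / 2) (1 / 2) ∧
      b * dist x y < |f y - f x| := by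
    rintro x ⟨hx, -⟩
    have h1 : ∀ᶠ y in 𝓝[≠] x, dist y x < min (s / 2) (1 / 2) :=
      nhdsWithin_le_nhds (ball_mem_nhds x (by positivity))
    obtain ⟨y, hy1, hy2, hy3⟩ := (Frequently.and_eventually hx
      (h1.and eventually_mem_nhdsWithin)).exists
    refine ⟨y, dist_pos.2 (Ne.symm hy3), by rwa [dist_comm], by rwa [dist_comm]⟩
  choose! y hy0 hys hyf using hy
  let S : ℕ → Set X := fun N => {x | x ∈ T ∧ 1 / ((N : ℝ) + 1) ≤ dist x (y x)}
  have hSmono : Monotone S := by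
    rintro N N' hN x ⟨hx, h1⟩
    refine ⟨hx, le_trans ?_ h1⟩
    gcongr
  have hST : ⋃ N, S N = T := by
    refine Set.Subset.antisymm (Set.iUnion_subset fun N x hx => hx.1) fun x hx => ?_
    obtain ⟨N, hN⟩ := exists_nat_one_div_lt (hy0 x hx)
    exact Set.mem_iUnion.2 ⟨N, hx, hN.le⟩
  obtain ⟨N, hN⟩ : ∃ N, m T / 2 < m (S N) := by
    have h1 : m T / 2 < ⨆ N, m (S N) := by
      rw [← hSmono.measure_iUnion, hST]
      exact ENNReal.half_lt_self hTpos (measure_ne_top _ _)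
    exact lt_iSup_iff.1 h1
  obtain ⟨k, hk⟩ := exists_nat_one_div_lt
    (show 0 < σ * (1 / ((N : ℝ) + 1)) / (4 * (1 + a₁)) from
      div_pos (by positivity) (by linarith))
  rw [lt_div_iff₀ (by linarith)] at hk
  obtain ⟨A', s', hs', hA'1, hA'2, hAA'⟩ := hA k
  have hu : ∀ y z, dist y z ≤ min s s' → |(A - A') y - (A - A') z| ≤ (2 * K) * dist y z := by
    intro y z hyz
    have h1 := abs_le.1 (hA1 y z (hyz.trans (min_le_left _ _)))
    have h2 := abs_le.1 (hA'1 y z (hyz.trans (min_le_right _ _)))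
    simp only [Pi.sub_apply]
    rw [abs_le]
    constructor <;> linarith
  have hss : 0 < min s s' := lt_min hs hs'
  obtain ⟨B, hB, hBδ, hBu⟩ := exists_isOpen_frequently_oscillation_le h hC hpos
    (show 0 ≤ 2 * K by positivity) ha₀0 hss hu hn'.le hAA' hε
  have hg := isUpperGradientWrt_of_frequently (by positivity) ha₀0.le hss hu hB.measurableSet hBu
  have hdens : ENNReal.ofReal c * m (S N) ≤ C ^ 3 * m B := by
    refine mul_measure_le_of_density (ρ := fun x => Λ * (2 * dist x (y x))) (R := Λ) h hB
      (fun x hx => mul_pos hΛ (mul_pos two_pos (hy0 x hx.1))) (fun x hx => ?_) fun x hx => ?_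
    · have := (hys x hx.1).trans_le (min_le_right _ _)
      nlinarith
    · have h1 := (hys x hx.1).trans_le (min_le_left _ _)
      have h2 := (hys x hx.1).trans_le (min_le_right _ _)
      refine le_measure_inter_of_slope_gap (K := K) (a := a₂) (b := b) (n := n) (f := f) (s := s)
        h hC hpos hP hP0 hΛ hK.le
        ha₀0.le hf hA1 (hA2 x hx.1.2) hA'2 (continuous_of_locally_lipschitz hss hu)
        hB.measurableSet hg (hy0 x hx.1) (by linarith) (by linarith) rfl (hyf x hx.1) ?_
        (by rw [hσ]; linarith) hn.le hσ0 hc' ha₀σ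
      calc 4 * ((1 + a₁) / ((k : ℝ) + 1)) = 1 / ((k : ℝ) + 1) * (4 * (1 + a₁)) := by ring
        _ ≤ σ * (1 / ((N : ℝ) + 1)) := hk.le
        _ ≤ σ * dist x (y x) := by gcongr; exact hx.2
  have hlt : ENNReal.ofReal c * m (S N) < ENNReal.ofReal c * m (S N) := by
    calc ENNReal.ofReal c * m (S N) ≤ C ^ 3 * m B := hdens
      _ ≤ C ^ 3 * δ := by gcongr
      _ = C ^ 3 * (C ^ 3)⁻¹ * (ENNReal.ofReal c * (m T / 2)) := by rw [hδ]; ring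
      _ ≤ 1 * (ENNReal.ofReal c * (m T / 2)) := by gcongr; exact ENNReal.mul_inv_le_one _
      _ = ENNReal.ofReal c * (m T / 2) := one_mul _
      _ < ENNReal.ofReal c * m (S N) :=
        ENNReal.mul_lt_mul_right (ENNReal.ofReal_pos.2 hc0).ne' ENNReal.ofReal_ne_top hN
  exact lt_irrefl _ hlt

end SlopeGap

section Density

variable {X : Type*} [MetricSpace X] [MeasurableSpace X] [BorelSpace X] {m : Measure X}
  [IsFiniteMeasure m]

theorem ae_mem_eventually_forall_ball_exists_dist_lt [SecondCountableTopology X] {C : ℝ≥0∞}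
    (h : ∀ (x : X) (r : ℝ), 0 < r → m (ball x (2 * r)) ≤ C * m (ball x r)) (hC : C ≠ ∞)
    (S : Set X) :
    ∀ᵐ x ∂m.restrict S, ∀ ε : ℝ, 0 < ε →
      ∀ᶠ r in 𝓝[>] (0 : ℝ), ∀ z ∈ ball x r, ∃ z' ∈ S, dist z' z < ε * r := by
  have := isUnifLocDoublingMeasure_of_ball h hC
  filter_upwards [IsUnifLocDoublingMeasure.ae_tendsto_measure_inter_div m S 1] with x hx ε' hε'
  obtain ⟨ε, hε, hεε', hε1⟩ : ∃ ε : ℝ, 0 < ε ∧ ε ≤ ε' ∧ ε ≤ 1 :=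
    ⟨min ε' 1, lt_min hε' one_pos, min_le_left _ _, min_le_right _ _⟩
  obtain ⟨n, hn⟩ := pow_unbounded_of_one_lt (4 / ε) (one_lt_two (α := ℝ))
  rw [div_lt_iff₀ hε] at hn
  have hCn : C ^ n ≠ ∞ := by finiteness
  have hlim : Tendsto (fun r : ℝ => m (S ∩ closedBall x (2 * r)) / m (closedBall x (2 * r)))
      (𝓝[>] 0) (𝓝 1) := by
    refine hx (fun _ => x) (fun r => 2 * r) ?_ ?_
    · refine tendsto_nhdsWithin_iff.2 ⟨?_, ?_⟩
      · have : Tendsto (fun r : ℝ => 2 * r) (𝓝 0) (𝓝 (2 * 0)) := tendsto_id.const_mul 2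
        rw [mul_zero] at this
        exact this.mono_left nhdsWithin_le_nhds
      · filter_upwards [self_mem_nhdsWithin] with r hr
        exact mul_pos two_pos (Set.mem_Ioi.1 hr)
    · filter_upwards [self_mem_nhdsWithin] with r hr
      exact mem_closedBall_self (by have := Set.mem_Ioi.1 hr; positivity)
  have hlt : 1 - (C ^ n)⁻¹ < 1 :=
    ENNReal.sub_lt_self ENNReal.one_ne_top one_ne_zero (ENNReal.inv_ne_zero.2 hCn)
  filter_upwards [hlim.eventually (lt_mem_nhds hlt), self_mem_nhdsWithin] with r hr hr0 z hz
  rw [Set.mem_Ioi] at hr0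
  by_contra! hcon
  set W := closedBall x (2 * r)
  have hεr : ε * r ≤ ε' * r := by gcongr
  have hεr1 : ε * r ≤ r := by nlinarith
  rw [mem_ball] at hz
  have hdisj : Disjoint (S ∩ W) (ball z (ε * r)) := by
    rw [Set.disjoint_left]
    intro w hw hw'
    exact absurd (mem_ball.1 hw') (not_lt.2 (hεr.trans (hcon w hw.1)))
  have hsub : (S ∩ W) ∪ ball z (ε * r) ⊆ W := Set.union_subset Set.inter_subset_right
    (ball_subset_closedBall.trans (closedBall_subset_closedBall' (by linarith)))
  have h1 : m (S ∩ W) + m (ball z (ε * r)) ≤ m W := by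
    rw [← measure_union hdisj measurableSet_ball]
    exact measure_mono hsub
  have h2 : m W ≤ C ^ n * m (ball z (ε * r)) :=
    (measure_mono (closedBall_subset_ball (show 2 * r < 3 * r by linarith))).trans
      (measure_ball_le_of_le h n x z (by positivity) (by rw [dist_comm]; nlinarith))
  have h3 : (C ^ n)⁻¹ * m W ≤ m (ball z (ε * r)) := by
    calc (C ^ n)⁻¹ * m W ≤ (C ^ n)⁻¹ * (C ^ n * m (ball z (ε * r))) := by gcongr
      _ = (C ^ n)⁻¹ * C ^ n * m (ball z (ε * r)) := by ring
      _ ≤ 1 * m (ball z (ε * r)) := by gcongr; exact ENNReal.inv_mul_le_one _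
      _ = _ := one_mul _
  refine absurd hr (not_lt.2 (ENNReal.div_le_of_le_mul ?_))
  rw [ENNReal.sub_mul (fun _ _ => measure_ne_top _ _), one_mul]
  refine ENNReal.le_sub_of_add_le_right (h3.trans_lt (measure_lt_top m _)).ne (le_trans ?_ h1)
  gcongr

/-- Almost everywhere, the pointwise Lipschitz bound at a point holds asymptotically for all pairs
of nearby points. -/
theorem ae_eventually_forall_ball_abs_sub_le [SecondCountableTopology X] {C : ℝ≥0∞}
    (h : ∀ (x : X) (r : ℝ), 0 < r → m (ball x (2 * r)) ≤ C * m (ball x r)) (hC : C ≠ ∞)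
    {f : X → ℝ} {K : ℝ} (hK : 0 ≤ K)
    (hf : ∀ y z, |f y - f z| ≤ K * dist y z) :
    ∀ᵐ x ∂m, ∀ c : ℚ, 0 ≤ c → (∀ᶠ y in 𝓝 x, |f y - f x| ≤ c * dist y x) → ∀ ε : ℝ, 0 < ε →
      ∀ᶠ r in 𝓝[>] (0 : ℝ), ∀ y ∈ ball x r, ∀ z ∈ ball x r, |f y - f z| ≤ c * dist y z + ε * r := by
  have hfc : Continuous f := continuous_of_locally_lipschitz zero_lt_one fun y z _ => hf y z
  let A : ℚ → ℕ → Set X := fun c k =>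
    {x | ∀ y ∈ ball x (1 / ((k : ℝ) + 1)), |f y - f x| ≤ c * dist y x}
  have hAm : ∀ c k, MeasurableSet (A c k) := by
    intro c k
    have h1 : A c k = ⋂ y, {x | 1 / ((k : ℝ) + 1) ≤ dist y x} ∪ {x | |f y - f x| ≤ c * dist y x} := by
      ext x
      simp only [A, mem_ball, Set.mem_ofPred_eq, Set.mem_iInter, Set.mem_union,
        ← not_lt (b := 1 / ((k : ℝ) + 1)), ← imp_iff_not_or]
    rw [h1]
    exact (isClosed_iInter fun y => (isClosed_le (by fun_prop) (by fun_prop)).union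
      (isClosed_le (by fun_prop) (by fun_prop))).measurableSet
  have hae : ∀ c k, ∀ᵐ x ∂m, x ∈ A c k → ∀ ε : ℝ, 0 < ε →
      ∀ᶠ r in 𝓝[>] (0 : ℝ), ∀ z ∈ ball x r, ∃ z' ∈ A c k, dist z' z < ε * r := fun c k =>
    (ae_restrict_iff' (hAm c k)).1
      (ae_mem_eventually_forall_ball_exists_dist_lt h hC (A c k))
  filter_upwards [ae_all_iff.2 fun c => ae_all_iff.2 fun k => hae c k] with x hx c hc hcx ε hε
  obtain ⟨δ, hδ, hδx⟩ := Metric.eventually_nhds_iff.1 hcx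
  obtain ⟨k, hk⟩ := exists_nat_one_div_lt hδ
  have hxA : x ∈ A c k := fun y hy => hδx ((mem_ball.1 hy).trans hk)
  have hc' : (0 : ℝ) ≤ c := by exact_mod_cast hc
  set ε₁ := min 1 (ε / (c + K + 1)) with hε₁
  have hε₁0 : 0 < ε₁ := by positivity
  have hε₁' : (c + K) * ε₁ ≤ ε := by
    calc (c + K) * ε₁ ≤ (c + K + 1) * (ε / (c + K + 1)) :=
          mul_le_mul (by linarith) (min_le_right _ _) hε₁0.le (by linarith)
      _ = ε := by field_simp
  filter_upwards [hx c k hxA ε₁ hε₁0, Ioo_mem_nhdsGT (show 0 < 1 / ((k : ℝ) + 1) / 3 by positivity)]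
    with r hr hr0 y hy z hz
  obtain ⟨z', hz'A, hz'⟩ := hr z hz
  rw [mem_ball] at hy hz
  have h1 : ε₁ * r ≤ r := by nlinarith [min_le_left 1 (ε / (c + K + 1)), hr0.1]
  have h2 := dist_triangle4 y x z z'
  have h3 := dist_triangle y z z'
  rw [dist_comm] at hz'
  rw [dist_comm x z] at h2
  have h4 := hz'A y (by rw [mem_ball]; linarith [hr0.2])
  have h5 := hf z z'
  rw [abs_sub_comm] at h5
  have h6 := abs_sub_le (f y) (f z') (f z)
  have h7 : (c : ℝ) * dist y z' ≤ c * (dist y z + ε₁ * r) := by gcongr; linarith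
  have h8 : K * dist z z' ≤ K * (ε₁ * r) := by gcongr
  have h9 : (c + K) * ε₁ * r ≤ ε * r := by have := hr0.1; gcongr
  linarith

end Density

section PointwiseLipschitz

variable {X : Type*} [MetricSpace X] {f : X → ℝ} {K : ℝ}

theorem isBoundedUnder_slope (hf : ∀ y z, |f y - f z| ≤ K * dist y z) (x : X) :
    IsBoundedUnder (· ≤ ·) (𝓝[≠] x) fun y => |f y - f x| / dist y x := by
  refine isBoundedUnder_of_eventually_le (a := K) ?_
  filter_upwards [self_mem_nhdsWithin] with y hy
  rw [div_le_iff₀ (dist_pos.2 hy)]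
  exact hf y x

theorem isCoboundedUnder_slope (x : X) [(𝓝[≠] x).NeBot] :
    IsCoboundedUnder (· ≤ ·) (𝓝[≠] x) fun y => |f y - f x| / dist y x :=
  IsBoundedUnder.isCoboundedUnder_le
    (isBoundedUnder_of_eventually_ge (a := 0) (Eventually.of_forall fun _ => by positivity))

theorem pLip_eq_zero_of_isolated (f : X → ℝ) {x : X} (hx : 𝓝[≠] x = ⊥) : pLip f x = 0 := by
  rw [pLip, hx, limsup_eq]
  simp

theorem pLip_nonneg (hf : ∀ y z, |f y - f z| ≤ K * dist y z) (x : X) : 0 ≤ pLip f x := by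
  rcases eq_or_neBot (𝓝[≠] x) with hx | hx
  · exact (pLip_eq_zero_of_isolated f hx).ge
  · by_contra! h
    obtain ⟨y, hy⟩ := (eventually_lt_of_limsup_lt h (isBoundedUnder_slope hf x)).exists
    exact absurd hy (not_lt.2 (by positivity))

theorem eventually_abs_sub_le_of_pLip_lt (hf : ∀ y z, |f y - f z| ≤ K * dist y z) {x : X} {c : ℝ}
    (hc : pLip f x < c) : ∀ᶠ y in 𝓝 x, |f y - f x| ≤ c * dist y x := by
  have h1 := eventually_lt_of_limsup_lt hc (isBoundedUnder_slope hf x)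
  rw [eventually_nhdsWithin_iff] at h1
  filter_upwards [h1] with y hy
  rcases eq_or_ne y x with rfl | hyx
  · simp
  · exact ((div_lt_iff₀ (dist_pos.2 hyx)).1 (hy hyx)).le

theorem frequently_lt_abs_sub_of_lt_pLip {x : X} [(𝓝[≠] x).NeBot] {b : ℝ} (hb : b < pLip f x) :
    ∃ᶠ y in 𝓝[≠] x, b * dist y x < |f y - f x| := by
  have h1 := frequently_lt_of_lt_limsup (isCoboundedUnder_slope x) hb
  refine (h1.and_eventually self_mem_nhdsWithin).mono fun y hy => ?_
  exact (lt_div_iff₀ (dist_pos.2 hy.2)).1 hy.1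

theorem sq_div_le_sq (hf : ∀ y z, |f y - f z| ≤ K * dist y z) (hK : 0 ≤ K) {x y : X} {r : ℝ}
    (hr : 0 < r) (hy : y ∈ ball x r) : ((f y - f x) / r) ^ 2 ≤ K ^ 2 := by
  rw [div_pow, div_le_iff₀ (by positivity), ← mul_pow, ← sq_abs]
  have := (mem_ball.1 hy).le
  gcongr
  exact (hf y x).trans (by gcongr)

variable [MeasurableSpace X] {m : Measure X}

theorem ksr_sq (m : Measure X) (f : X → ℝ) (r : ℝ) (x : X) :
    ksr m f r x ^ 2 = ⨍ y in ball x r, ((f y - f x) / r) ^ 2 ∂m := by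
  rw [ksr, Real.sq_sqrt]
  rw [setAverage_eq, smul_eq_mul]
  exact mul_nonneg (by positivity) (integral_nonneg fun _ => sq_nonneg _)

theorem ksr_sq_le [IsFiniteMeasure m] (hf : ∀ y z, |f y - f z| ≤ K * dist y z) (hK : 0 ≤ K)
    (x : X) {r : ℝ} (hr : 0 < r) : ksr m f r x ^ 2 ≤ K ^ 2 := by
  rw [ksr_sq, setAverage_eq, smul_eq_mul]
  have h1 := norm_setIntegral_le_of_norm_le_const (μ := m) (s := ball x r) (C := K ^ 2)
    (f := fun y => ((f y - f x) / r) ^ 2) (measure_lt_top _ _) fun y hy => by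
      rw [Real.norm_eq_abs, abs_of_nonneg (sq_nonneg _)]
      exact sq_div_le_sq hf hK hr hy
  rcases (measureReal_nonneg (μ := m) (s := ball x r)).eq_or_lt with h0 | h0
  · rw [← h0]
    simpa using sq_nonneg K
  · rw [inv_mul_le_iff₀ h0, mul_comm]
    exact (le_abs_self _).trans h1

theorem le_ksr_sq [BorelSpace X] [IsFiniteMeasure m]
    (hf : ∀ y z, |f y - f z| ≤ K * dist y z) (hK : 0 ≤ K)
    {x : X} {r q A : ℝ} {V : Set X} (hr : 0 < r) (hVm : MeasurableSet V) (hV : V ⊆ ball x r)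
    (hq : 0 ≤ q) (hqV : ∀ z ∈ V, q * r ≤ |f z - f x|) (hA : 0 < A) (hm : 0 < m (ball x r))
    (hAm : m.real (ball x r) ≤ A * m.real V) : q ^ 2 / A ≤ ksr m f r x ^ 2 := by
  have hfc : Continuous f := continuous_of_locally_lipschitz zero_lt_one fun y z _ => hf y z
  have h0 : 0 < m.real (ball x r) := ENNReal.toReal_pos hm.ne' (measure_ne_top _ _)
  have hInt : IntegrableOn (fun y => ((f y - f x) / r) ^ 2) (ball x r) m := by
    have hc : Continuous fun y => ((f y - f x) / r) ^ 2 := by fun_prop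
    refine Integrable.of_bound (C := K ^ 2) hc.measurable.aestronglyMeasurable ?_
    filter_upwards [ae_restrict_mem measurableSet_ball] with y hy
    rw [Real.norm_eq_abs, abs_of_nonneg (sq_nonneg _)]
    exact sq_div_le_sq hf hK hr hy
  rw [ksr_sq, setAverage_eq, smul_eq_mul, le_inv_mul_iff₀ h0]
  calc m.real (ball x r) * (q ^ 2 / A) ≤ (A * m.real V) * (q ^ 2 / A) := by gcongr
    _ = ∫ _ in V, q ^ 2 ∂m := by
      rw [setIntegral_const, smul_eq_mul]; field_simp
    _ ≤ ∫ y in V, ((f y - f x) / r) ^ 2 ∂m := by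
      refine setIntegral_mono_on (integrableOn_const (measure_ne_top _ _)) (hInt.mono_set hV) hVm
        fun z hz => ?_
      rw [div_pow, le_div_iff₀ (by positivity), ← mul_pow, ← sq_abs (f z - f x)]
      have := hqV z hz
      gcongr
    _ ≤ _ := setIntegral_mono_set hInt (Eventually.of_forall fun _ => sq_nonneg _)
      (LE.le.eventuallyLE hV)

end PointwiseLipschitz

theorem stmt_6 {X : Type*} [MetricSpace X] [CompleteSpace X]
    [TopologicalSpace.SeparableSpace X] [MeasurableSpace X] [BorelSpace X]
    (m : Measure X) [IsFiniteMeasure m]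
    (C_D : ℝ) (hCD : 1 ≤ C_D)
    (hdoub : ∀ (x : X) (r : ℝ), 0 < r →
      m (Metric.ball x (2 * r)) ≤ ENNReal.ofReal C_D * m (Metric.ball x r))
    (hpoin : SupportsPoincare m)
    (f : X → ℝ) (K : ℝ≥0) (hf : LipschitzWith K f) :
    ∀ᵐ x ∂m,
      ((3 / 8 : ℝ) ^ 2 / C_D ^ 5) * (pLip f x) ^ 2 ≤
        Filter.liminf (fun r => (ksr m f r x) ^ 2) (𝓝[>] (0:ℝ)) := by
  rcases eq_or_ne m 0 with rfl | hm
  · simp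
  have : SecondCountableTopology X := UniformSpace.secondCountable_of_separable X
  have hf' : ∀ y z, |f y - f z| ≤ K * dist y z := fun y z => by
    simpa [Real.dist_eq] using hf.dist_le_mul y z
  have hC : ENNReal.ofReal C_D ≠ ∞ := ENNReal.ofReal_ne_top
  have hpos : ∀ (x : X) (r : ℝ), 0 < r → 0 < m (ball x r) := fun x r hr =>
    measure_ball_pos_of_doubling hdoub hm x hr
  obtain ⟨Λ, hΛ, hP⟩ := hpoin
  obtain ⟨P, hP1, hP⟩ := hP 1 one_pos
  have hgap : ∀ᵐ x ∂m, ∀ a b : ℚ, (0 : ℝ) ≤ a → (a : ℝ) < b →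
      ¬ ((∃ᶠ r in 𝓝[>] (0 : ℝ), ∀ y ∈ ball x r, |f y - f x| ≤ a * r) ∧
        ∃ᶠ y in 𝓝[≠] x, b * dist y x < |f y - f x|) := by
    refine ae_all_iff.2 fun a => ae_all_iff.2 fun b => ?_
    by_cases hab : (0 : ℝ) ≤ a ∧ (a : ℝ) < b
    · have h0 := measure_slope_gap_eq_zero hdoub hC hpos hP (zero_le_one.trans hP1)
        (one_pos.trans_le hΛ) (K := max K b) (f := f)
        (fun y z => (hf' y z).trans (by gcongr; exact le_max_left _ _)) hab.1 hab.2
        (le_max_right _ _)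
      filter_upwards [measure_eq_zero_iff_ae_notMem.1 h0] with x hx _ _ using hx
    · exact Eventually.of_forall fun x h1 h2 => absurd ⟨h1, h2⟩ hab
  filter_upwards [hgap, ae_eventually_forall_ball_abs_sub_le hdoub hC K.2 hf'] with x hx hx'
  have hcob : IsCoboundedUnder (· ≥ ·) (𝓝[>] (0 : ℝ)) fun r => ksr m f r x ^ 2 := by
    refine IsBoundedUnder.isCoboundedUnder_ge (isBoundedUnder_of_eventually_le (a := (K : ℝ) ^ 2) ?_)
    filter_upwards [self_mem_nhdsWithin] with r hr
    exact ksr_sq_le hf' K.2 x hr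
  have hL0 := pLip_nonneg hf' x
  rcases hL0.eq_or_lt with hL | hL
  · rw [← hL]
    refine le_liminf_of_le hcob (Eventually.of_forall fun r => ?_)
    simpa using sq_nonneg (ksr m f r x)
  have hne : (𝓝[≠] x).NeBot := by
    by_contra h
    exact hL.ne' (pLip_eq_zero_of_isolated f (not_neBot.1 h))
  set L := pLip f x with hLdef
  have hC0 : 0 < C_D := by linarith
  refine le_of_forall_lt fun v hv => ?_
  have hv' : v < (3 / 8 * L - 2 * 0) ^ 2 / C_D ^ 4 := by
    refine hv.trans_le ?_
    calc (3 / 8 : ℝ) ^ 2 / C_D ^ 5 * L ^ 2 = (3 / 8 * L - 2 * 0) ^ 2 / C_D ^ 5 := by ring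
      _ ≤ (3 / 8 * L - 2 * 0) ^ 2 / C_D ^ 4 := by gcongr; norm_num
  have hcts : Continuous fun e : ℝ => (3 / 8 * L - 2 * e) ^ 2 / C_D ^ 4 := by fun_prop
  obtain ⟨e, hev, he0, heL⟩ := ((hcts.continuousAt.tendsto.mono_left
    (nhdsWithin_le_nhds (s := Set.Ioi 0))).eventually (lt_mem_nhds hv') |>.and
      (Ioo_mem_nhdsGT (show 0 < 3 / 16 * L by positivity))).exists
  obtain ⟨a, ha, haL⟩ := exists_rat_btwn (show L - e < L by linarith)
  obtain ⟨b, hb, hbL⟩ := exists_rat_btwn haL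
  obtain ⟨c, hc, hcL⟩ := exists_rat_btwn (show L < L + e by linarith)
  have hosc : ∀ᶠ r in 𝓝[>] (0 : ℝ), ∃ y ∈ ball x r, a * r < |f y - f x| := by
    have h1 := hx a b (by linarith) hb
    rw [not_and'] at h1
    have h2 := h1 (frequently_lt_abs_sub_of_lt_pLip hbL)
    rw [not_frequently] at h2
    filter_upwards [h2] with r hr
    push Not at hr
    exact hr
  have hhalf : Tendsto (fun r : ℝ => r / 2) (𝓝[>] 0) (𝓝[>] 0) := by
    refine tendsto_nhdsWithin_iff.2 ⟨?_, ?_⟩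
    · have : Tendsto (fun r : ℝ => r / 2) (𝓝 0) (𝓝 (0 / 2)) := tendsto_id.div_const 2
      rw [zero_div] at this
      exact this.mono_left nhdsWithin_le_nhds
    · filter_upwards [self_mem_nhdsWithin] with r hr
      exact half_pos (Set.mem_Ioi.1 hr)
  have hlip := hx' c (by exact_mod_cast (hL0.trans hc.le))
    (eventually_abs_sub_le_of_pLip_lt hf' hc) e he0
  refine hev.trans_le (le_liminf_of_le hcob ?_)
  filter_upwards [hhalf.eventually hosc, hlip, self_mem_nhdsWithin] with r hr1 hr2 hr0
  rw [Set.mem_Ioi] at hr0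
  obtain ⟨y, hy, hyx⟩ := hr1
  rw [mem_ball] at hy
  have hyr : y ∈ ball x r := by rw [mem_ball]; linarith
  have hsub : ball y (r / 8) ⊆ ball x r := ball_subset_ball' (by linarith)
  refine le_ksr_sq hf' K.2 hr0 measurableSet_ball hsub (by linarith) (fun z hz => ?_)
    (by positivity) (hpos x r hr0) ?_
  · have h1 := hr2 z (hsub hz) y hyr
    rw [mem_ball] at hz
    have hc0 : (0 : ℝ) ≤ c := by linarith
    have h2 : (c : ℝ) * dist z y ≤ (L + e) * (r / 8) := by gcongr
    have h3 := abs_sub_le (f y) (f z) (f x)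
    rw [abs_sub_comm (f y) (f z)] at h3
    have h4 : (L - e) * (r / 2) ≤ a * (r / 2) := by gcongr
    nlinarith [mul_pos he0 hr0]
  · have h1 := ENNReal.toReal_mono (by finiteness)
      (measure_ball_le_of_le hdoub 4 x y (R := r) (r := r / 8) (by positivity)
        (by rw [dist_comm]; linarith))
    rwa [ENNReal.toReal_mul, ENNReal.toReal_pow, ENNReal.toReal_ofReal hC0.le] at h1
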